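/- arXiv:2108.02027 — 2 statements merged into one kernel-verified Lean document; each statement's English description precedes it below -/
import Mathlib

section
/- Let w = w₁…w_{|w|} and v = v₁…v_{|v|} be nonempty words in W_* such that w_k ≠ v_k for some k ∈ {1,…,min(|w|,|v|)}. Then K_w ∩ K_v has at most one element, and f_w(△) ∩ f_v(△) = K_w ∩ K_v = f_w(V0) ∩ f_v(V0). -/
open scoped BigOperators ENNReal
open Set Filter MeasureTheory

noncomputable section

abbrev E2 : Type := EuclideanSpace ℝ (Fin 2)

/-- The index set `S_l` of the level-`l` thin Sierpinski gasket. -/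
def Sset (l : ℕ) : Set (ℕ × ℕ) :=
  {p | p.1 + p.2 ≤ l - 1 ∧ p.1 * p.2 * (l - 1 - p.1 - p.2) = 0}

/-- The contraction `f^l_i`. -/
def fmap (q : Fin 3 → E2) (l : ℕ) (i : ℕ × ℕ) (x : E2) : E2 :=
  q 0 + ((i.1 : ℝ) / l) • (q 1 - q 0) + ((i.2 : ℝ) / l) • (q 2 - q 0)
    + (l : ℝ)⁻¹ • (x - q 0)

/-- The closed equilateral triangle `△`. -/
def Tri (q : Fin 3 → E2) : Set E2 := convexHull ℝ (Set.range q)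

def V0 (q : Fin 3 → E2) : Set E2 := Set.range q

/-- Words of length `n` (padded by `(0,0)` beyond position `n`). -/
def Wn (l : ℕ → ℕ) (n : ℕ) : Set (ℕ → ℕ × ℕ) :=
  {w | (∀ k, k < n → w k ∈ Sset (l k)) ∧ ∀ k, n ≤ k → w k = (0, 0)}

/-- `wordMap q l w n = f^{l_1}_{w_1} ∘ ⋯ ∘ f^{l_n}_{w_n}` (0-indexed). -/
def wordMap (q : Fin 3 → E2) (l : ℕ → ℕ) (w : ℕ → ℕ × ℕ) : ℕ → E2 → E2
  | 0 => id
  | n + 1 => wordMap q l w n ∘ fmap q (l n) (w n)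

/-- The thin scale irregular Sierpinski gasket `K`. -/
def Gasket (q : Fin 3 → E2) (l : ℕ → ℕ) : Set E2 :=
  ⋂ n, ⋃ w ∈ Wn l n, wordMap q l w n '' Tri q

/-- The cell `K_w = K ∩ f_w(△)`. -/
def Cell (q : Fin 3 → E2) (l : ℕ → ℕ) (n : ℕ) (w : ℕ → ℕ × ℕ) : Set E2 :=
  Gasket q l ∩ wordMap q l w n '' Tri q

def Vn (q : Fin 3 → E2) (l : ℕ → ℕ) (n : ℕ) : Set E2 :=
  ⋃ w ∈ Wn l n, wordMap q l w n '' V0 q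

def Vstar (q : Fin 3 → E2) (l : ℕ → ℕ) : Set E2 := ⋃ n, Vn q l n

def Ln (l : ℕ → ℕ) (n : ℕ) : ℕ := ∏ k ∈ Finset.range n, l k

def Mn (l : ℕ → ℕ) (n : ℕ) : ℕ := ∏ k ∈ Finset.range n, (3 * l k - 3)

def rl (l : ℕ) : ℝ := (2 * (l : ℝ) / 3 + 1 / 9)⁻¹

def Rn (l : ℕ → ℕ) (n : ℕ) : ℝ := ∏ k ∈ Finset.range n, rl (l k)

def Tn (l : ℕ → ℕ) (n : ℕ) : ℝ := (Mn l n : ℝ) / Rn l n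

/-- The basic energy form `E⁰` on `ℝ^{V₀}`. -/
def E0 (q : Fin 3 → E2) (u v : E2 → ℝ) : ℝ :=
  (1 / 2) * ∑ j : Fin 3, ∑ k : Fin 3, (u (q j) - u (q k)) * (v (q j) - v (q k))

/-- The level-`n` energy form `Eⁿ`. -/
def En (q : Fin 3 → E2) (l : ℕ → ℕ) (n : ℕ) (u v : E2 → ℝ) : ℝ :=
  (Rn l n)⁻¹ * ∑ᶠ w ∈ Wn l n, E0 q (u ∘ wordMap q l w n) (v ∘ wordMap q l w n)

/-- The domain `F` of the limit resistance form. -/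
def FDom (q : Fin 3 → E2) (l : ℕ → ℕ) : Set (E2 → ℝ) :=
  {u | ∃ C : ℝ, ∀ n, En q l n u u ≤ C}

/-- The limit form `E(u,v) = lim_n Eⁿ(u,v)`. -/
def EForm (q : Fin 3 → E2) (l : ℕ → ℕ) (u v : E2 → ℝ) : ℝ :=
  limUnder atTop fun n => En q l n u v

/-- The intrinsic (geodesic) distance on `K`, with values in `ℝ≥0∞`. -/
def pdist (q : Fin 3 → E2) (l : ℕ → ℕ) (x y : E2) : ℝ≥0∞ :=
  ⨅ (γ : ℝ → E2) (_ : ContinuousOn γ (Set.Icc 0 1))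
    (_ : Set.MapsTo γ (Set.Icc 0 1) (Gasket q l)) (_ : γ 0 = x) (_ : γ 1 = y),
    eVariationOn γ (Set.Icc 0 1)

def gdist (q : Fin 3 → E2) (l : ℕ → ℕ) (x y : E2) : ℝ := (pdist q l x y).toReal

/-- The set of resistance quotients used to define `R_E`. -/
def REset (q : Fin 3 → E2) (l : ℕ → ℕ) (x y : E2) : Set ℝ :=
  {t | ∃ u ∈ FDom q l, 0 < EForm q l u u ∧ t = (u x - u y) ^ 2 / EForm q l u u}

/-- The resistance metric `R_E`. -/
def RE (q : Fin 3 → E2) (l : ℕ → ℕ) (x y : E2) : ℝ := sSup (REset q l x y)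

/-- Resistance quotients over continuous representatives (i.e. `F` viewed in `C(K)`). -/
def REcSet (q : Fin 3 → E2) (l : ℕ → ℕ) (x y : E2) : Set ℝ :=
  {t | ∃ u ∈ FDom q l, ContinuousOn u (Gasket q l) ∧ 0 < EForm q l u u ∧
    t = (u x - u y) ^ 2 / EForm q l u u}

def REc (q : Fin 3 → E2) (l : ℕ → ℕ) (x y : E2) : ℝ := sSup (REcSet q l x y)

/-- The open `d`-ball in `K`. -/
def Bd (q : Fin 3 → E2) (l : ℕ → ℕ) (x : E2) (s : ℝ) : Set E2 :=
  {y ∈ Gasket q l | gdist q l x y < s}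

/-- The open `R_E`-ball in `K`. -/
def BRc (q : Fin 3 → E2) (l : ℕ → ℕ) (x : E2) (s : ℝ) : Set E2 :=
  {y ∈ Gasket q l | REc q l x y < s}

/-- `Λ^{(k)}_{n,w}`: words within `k` cell-steps of `w`. -/
def Lam (q : Fin 3 → E2) (l : ℕ → ℕ) (n : ℕ) (w : ℕ → ℕ × ℕ) (k : ℕ) :
    Set (ℕ → ℕ × ℕ) :=
  {v ∈ Wn l n | ∃ c : ℕ → ℕ → ℕ × ℕ, c 0 = w ∧ c k = v ∧ (∀ j ≤ k, c j ∈ Wn l n) ∧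
    ∀ j < k, (Cell q l n (c j) ∩ Cell q l n (c (j + 1))).Nonempty}

/-- `U^{(k)}_{n,w}`. -/
def Unwk (q : Fin 3 → E2) (l : ℕ → ℕ) (n : ℕ) (w : ℕ → ℕ × ℕ) (k : ℕ) : Set E2 :=
  ⋃ v ∈ Lam q l n w k, Cell q l n v

def betaZero (l : ℕ → ℕ) : ℝ :=
  ⨅ n : ℕ, Real.logb (l n) (2 * (l n : ℝ) ^ 2 - (5 / 3) * (l n : ℝ) - 1 / 3)

def betaOne (l : ℕ → ℕ) : ℝ :=
  ⨆ n : ℕ, Real.logb (l n) (2 * (l n : ℝ) ^ 2 - (5 / 3) * (l n : ℝ) - 1 / 3)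

def betaM (l : ℕ → ℕ) : ℝ := ⨅ n : ℕ, Real.logb (l n) (3 * (l n : ℝ) - 3)

def betaR (l : ℕ → ℕ) : ℝ := ⨆ n : ℕ, Real.logb (l n) ((rl (l n))⁻¹)

/-- The value of `Ψ` on the interval `[1/L_{n+1}, 1/L_n]`. -/
def psiPiece (l : ℕ → ℕ) (n : ℕ) (s : ℝ) : ℝ :=
  (Tn l (n + 1))⁻¹
    * (1 + ((3 * (l n : ℝ) - 4) / ((l n : ℝ) - 1)) * ((Ln l (n + 1) : ℝ) * s - 1))
    * (1 + (((2 / 3) * (l n : ℝ) - 8 / 9) / ((l n : ℝ) - 1)) * ((Ln l (n + 1) : ℝ) * s - 1))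

/-- `Ψ = Ψ_𝒍` is characterized by these defining clauses. -/
def IsPsi (l : ℕ → ℕ) (Psi : ℝ → ℝ) : Prop :=
  (∀ n : ℕ, ∀ s : ℝ, ((Ln l (n + 1) : ℝ))⁻¹ ≤ s → s ≤ ((Ln l n : ℝ))⁻¹ →
      Psi s = psiPiece l n s) ∧
  (∀ s : ℝ, 1 ≤ s → Psi s = s ^ betaZero l) ∧ Psi 0 = 0

def psiMPiece (l : ℕ → ℕ) (n : ℕ) (s : ℝ) : ℝ :=
  ((Mn l (n + 1) : ℝ))⁻¹
    * (1 + ((3 * (l n : ℝ) - 4) / ((l n : ℝ) - 1)) * ((Ln l (n + 1) : ℝ) * s - 1))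

def IsPsiM (l : ℕ → ℕ) (PsiM : ℝ → ℝ) : Prop :=
  (∀ n : ℕ, ∀ s : ℝ, ((Ln l (n + 1) : ℝ))⁻¹ ≤ s → s ≤ ((Ln l n : ℝ))⁻¹ →
      PsiM s = psiMPiece l n s) ∧
  (∀ s : ℝ, 1 ≤ s → PsiM s = s ^ betaM l) ∧ PsiM 0 = 0

def psiRPiece (l : ℕ → ℕ) (n : ℕ) (s : ℝ) : ℝ :=
  Rn l (n + 1)
    * (1 + (((2 / 3) * (l n : ℝ) - 8 / 9) / ((l n : ℝ) - 1)) * ((Ln l (n + 1) : ℝ) * s - 1))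

def IsPsiR (l : ℕ → ℕ) (PsiR : ℝ → ℝ) : Prop :=
  (∀ n : ℕ, ∀ s : ℝ, ((Ln l (n + 1) : ℝ))⁻¹ ≤ s → s ≤ ((Ln l n : ℝ))⁻¹ →
      PsiR s = psiRPiece l n s) ∧
  (∀ s : ℝ, 1 ≤ s → PsiR s = s ^ betaR l) ∧ PsiR 0 = 0

/-- `μ` is the uniform distribution on `K`: a Borel measure carried by `K`
with `μ(K_w) = 1/M_{|w|}` for every word `w`. -/
def IsUnif (q : Fin 3 → E2) (l : ℕ → ℕ) (μ : Measure E2) : Prop :=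
  μ (Gasket q l)ᶜ = 0 ∧ ∀ n : ℕ, ∀ w ∈ Wn l n, μ (Cell q l n w) = ((Mn l n : ℝ≥0∞))⁻¹

/-- `μ` is the energy measure of `u`: a Borel measure carried by `K` with
`μ(K_w) = R_{|w|}⁻¹ E^{𝒍^{|w|}}(u∘F_w, u∘F_w)` for every word `w`. -/
def IsEnergyMeasure (q : Fin 3 → E2) (l : ℕ → ℕ) (u : E2 → ℝ) (μ : Measure E2) : Prop :=
  μ (Gasket q l)ᶜ = 0 ∧ ∀ n : ℕ, ∀ w ∈ Wn l n,
    μ (Cell q l n w) = ENNReal.ofReal ((Rn l n)⁻¹ *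
      EForm q (fun k => l (k + n)) (u ∘ wordMap q l w n) (u ∘ wordMap q l w n))


/-- Affine coordinates. -/
def PP (q : Fin 3 → E2) (a b : ℝ) : E2 := q 0 + a • (q 1 - q 0) + b • (q 2 - q 0)

lemma PP_inj (q : Fin 3 → E2) (hq : ∀ j k : Fin 3, j ≠ k → dist (q j) (q k) = 1)
    {a b a' b' : ℝ} (h : PP q a b = PP q a' b') : a = a' ∧ b = b' := by
  have hu : ‖q 1 - q 0‖ = 1 := by rw [← dist_eq_norm]; exact hq _ _ (by decide)
  have ht : ‖q 2 - q 0‖ = 1 := by rw [← dist_eq_norm]; exact hq _ _ (by decide)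
  have hut : ‖(q 1 - q 0) - (q 2 - q 0)‖ = 1 := by
    rw [sub_sub_sub_cancel_right, ← dist_eq_norm]; exact hq _ _ (by decide)
  unfold PP at h
  generalize q 1 - q 0 = u at *
  generalize q 2 - q 0 = t at *
  have e := norm_sub_sq_real u t
  rw [hu, ht, hut] at e
  have h0 : (a - a') • u + (b - b') • t = 0 := by
    rw [sub_smul, sub_smul]
    have : a • u + b • t = a' • u + b' • t := by
      rw [add_assoc, add_assoc] at h
      exact add_left_cancel h
    rw [sub_add_sub_comm, this, sub_self]
  have n0 := norm_add_sq_real ((a - a') • u) ((b - b') • t)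
  rw [h0, norm_smul, norm_smul, inner_smul_left, inner_smul_right, hu, ht] at n0
  simp only [norm_zero, Real.norm_eq_abs, mul_one, sq_abs, conj_trivial] at n0
  have e' : inner ℝ u t = 1 / 2 := by linarith
  rw [e'] at n0
  have key : ∀ c d : ℝ, (0:ℝ)^2 = c^2 + 2 * (c * (d * (1/2))) + d^2 → c = 0 ∧ d = 0 := by
    intro c d h
    constructor <;> nlinarith [sq_nonneg (c + d), sq_nonneg c, sq_nonneg d]
  obtain ⟨h1, h2⟩ := key _ _ n0
  exact ⟨by linarith, by linarith⟩

lemma mem_Tri (q : Fin 3 → E2) (x : E2) :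
    x ∈ Tri q ↔ ∃ a b : ℝ, 0 ≤ a ∧ 0 ≤ b ∧ a + b ≤ 1 ∧ x = PP q a b := by
  constructor
  · intro hx
    have : Tri q ⊆ {x | ∃ a b : ℝ, 0 ≤ a ∧ 0 ≤ b ∧ a + b ≤ 1 ∧ x = PP q a b} := by
      apply convexHull_min
      · rintro _ ⟨i, rfl⟩
        fin_cases i
        · exact ⟨0, 0, by simp [PP]⟩
        · exact ⟨1, 0, by simp [PP]⟩
        · exact ⟨0, 1, by simp [PP]⟩
      · rintro _ ⟨a, b, ha, hb, hab, rfl⟩ _ ⟨a', b', ha', hb', hab', rfl⟩ s t hs ht hst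
        refine ⟨s * a + t * a', s * b + t * b', by positivity, by positivity, by nlinarith, ?_⟩
        obtain rfl : s = 1 - t := by linarith
        unfold PP
        module
    exact this hx
  · rintro ⟨a, b, ha, hb, hab, rfl⟩
    have hc : Convex ℝ (Tri q) := convex_convexHull ℝ _
    have hm : ∀ i, q i ∈ Tri q := fun i => subset_convexHull ℝ _ ⟨i, rfl⟩
    have := hc.sum_mem (t := Finset.univ) (w := ![1 - a - b, a, b]) (z := q)
      (by intro i _; fin_cases i <;> simp <;> linarith)
      (by simp [Fin.sum_univ_three]; ring) (fun i _ => hm i)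
    convert this using 1
    simp [Fin.sum_univ_three, PP]
    module

lemma mem_V0 (q : Fin 3 → E2) (x : E2) :
    x ∈ V0 q ↔ x = PP q 0 0 ∨ x = PP q 1 0 ∨ x = PP q 0 1 := by
  have h0 : PP q 0 0 = q 0 := by simp [PP]
  have h1 : PP q 1 0 = q 1 := by simp [PP]
  have h2 : PP q 0 1 = q 2 := by simp [PP]
  rw [h0, h1, h2]
  constructor
  · rintro ⟨i, rfl⟩
    fin_cases i <;> simp
  · rintro (rfl | rfl | rfl) <;> exact ⟨_, rfl⟩

lemma V0_sub_Tri (q : Fin 3 → E2) : V0 q ⊆ Tri q := subset_convexHull ℝ _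

lemma fmap_PP (q : Fin 3 → E2) (l : ℕ) (i : ℕ × ℕ) (a b : ℝ) :
    fmap q l i (PP q a b) = PP q ((i.1 + a) / l) ((i.2 + b) / l) := by
  unfold fmap PP
  simp only [div_eq_mul_inv]
  module

lemma fmap_Tri (q : Fin 3 → E2) {l : ℕ} (hl : 5 ≤ l) {i : ℕ × ℕ} (hi : i ∈ Sset l) {x : E2}
    (hx : x ∈ Tri q) : fmap q l i x ∈ Tri q := by
  rw [mem_Tri] at hx ⊢
  obtain ⟨a, b, ha, hb, hab, rfl⟩ := hx
  have h1 : i.1 + i.2 + 1 ≤ l := by have := hi.1; omega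
  have h2 : (i.1 : ℝ) + i.2 + 1 ≤ l := by exact_mod_cast h1
  have h3 : (0 : ℝ) < l := by exact_mod_cast (by omega : 0 < l)
  refine ⟨_, _, by positivity, by positivity, ?_, fmap_PP ..⟩
  rw [← add_div, div_le_one h3]
  linarith

lemma fmap_V0 (q : Fin 3 → E2) (hq : ∀ j k : Fin 3, j ≠ k → dist (q j) (q k) = 1)
    {l : ℕ} (hl : 5 ≤ l) {i : ℕ × ℕ} (hi : i ∈ Sset l) {x : E2}
    (hx : x ∈ Tri q) (h : fmap q l i x ∈ V0 q) : x ∈ V0 q := by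
  rw [mem_Tri] at hx
  obtain ⟨a, b, ha, hb, hab, rfl⟩ := hx
  have h1 : i.1 + i.2 + 1 ≤ l := by have := hi.1; omega
  have h2 : (i.1 : ℝ) + i.2 + 1 ≤ l := by exact_mod_cast h1
  have h3 : (0 : ℝ) < l := by exact_mod_cast (by omega : 0 < l)
  have p1 : (0 : ℝ) ≤ i.1 := by positivity
  have p2 : (0 : ℝ) ≤ i.2 := by positivity
  rw [mem_V0, fmap_PP] at h
  rw [mem_V0]
  rcases h with h | h | h
  all_goals
    obtain ⟨e1, e2⟩ := PP_inj q hq h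
    rw [div_eq_iff h3.ne'] at e1 e2
  · left
    rw [show a = 0 by linarith, show b = 0 by linarith]
  · right; left
    rw [show a = 1 by linarith, show b = 0 by linarith]
  · right; right
    rw [show a = 0 by linarith, show b = 1 by linarith]

lemma fmap_inj (q : Fin 3 → E2) {l : ℕ} (hl : 5 ≤ l) (i : ℕ × ℕ) :
    Function.Injective (fmap q l i) := by
  intro x y h
  have h3 : (l : ℝ)⁻¹ ≠ 0 := by
    have : (0 : ℝ) < l := by exact_mod_cast (by omega : 0 < l)
    positivity
  have := smul_right_injective E2 h3 (add_left_cancel h)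
  simpa using this

/-- Two distinct grid cells meet in at most one point, a common vertex. -/
lemma core (q : Fin 3 → E2) (hq : ∀ j k : Fin 3, j ≠ k → dist (q j) (q k) = 1)
    {l : ℕ} (hl : 5 ≤ l) {i j : ℕ × ℕ} (hij : i ≠ j) :
    ∃ p : E2, ∀ x ∈ Tri q, ∀ y ∈ Tri q, fmap q l i x = fmap q l j y →
      x ∈ V0 q ∧ y ∈ V0 q ∧ fmap q l i x = p := by
  have h3 : (0 : ℝ) < l := by exact_mod_cast (by omega : 0 < l)
  refine ⟨PP q ((max i.1 j.1 : ℕ) / l) ((max i.2 j.2 : ℕ) / l), ?_⟩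
  intro x hx y hy h
  rw [mem_Tri] at hx hy
  obtain ⟨a, b, ha, hb, hab, rfl⟩ := hx
  obtain ⟨c, d, hc, hd, hcd, rfl⟩ := hy
  rw [fmap_PP, fmap_PP] at h
  obtain ⟨e1, e2⟩ := PP_inj q hq h
  rw [div_left_inj' h3.ne'] at e1 e2
  rw [mem_V0, mem_V0, fmap_PP]
  obtain ⟨i1, i2⟩ := i
  obtain ⟨j1, j2⟩ := j
  simp only at e1 e2 ⊢
  have t1 : i1 ≤ j1 + 1 := by
    have : (i1 : ℝ) ≤ j1 + 1 := by linarith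
    exact_mod_cast this
  have t2 : j1 ≤ i1 + 1 := by
    have : (j1 : ℝ) ≤ i1 + 1 := by linarith
    exact_mod_cast this
  have t3 : i2 ≤ j2 + 1 := by
    have : (i2 : ℝ) ≤ j2 + 1 := by linarith
    exact_mod_cast this
  have t4 : j2 ≤ i2 + 1 := by
    have : (j2 : ℝ) ≤ i2 + 1 := by linarith
    exact_mod_cast this
  have c1 : i1 = j1 + 1 ∨ j1 = i1 + 1 ∨ i1 = j1 := by omega
  have c2 : i2 = j2 + 1 ∨ j2 = i2 + 1 ∨ i2 = j2 := by omega
  have v : ∀ a b a' b' : ℝ, a = a' → b = b' → PP q a b = PP q a' b' := by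
    rintro _ _ _ _ rfl rfl; rfl
  rcases c1 with rfl | rfl | rfl <;> rcases c2 with rfl | rfl | rfl <;> push_cast at e1 e2
  · exfalso; linarith
  · exact ⟨Or.inr (Or.inr (v _ _ _ _ (by linarith) (by linarith))),
      Or.inr (Or.inl (v _ _ _ _ (by linarith) (by linarith))),
      v _ _ _ _ (by congr 1; simp; linarith) (by congr 1; simp; linarith)⟩
  · exact ⟨Or.inl (v _ _ _ _ (by linarith) (by linarith)),
      Or.inr (Or.inl (v _ _ _ _ (by linarith) (by linarith))),
      v _ _ _ _ (by congr 1; simp; linarith) (by congr 1; simp; linarith)⟩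
  · exact ⟨Or.inr (Or.inl (v _ _ _ _ (by linarith) (by linarith))),
      Or.inr (Or.inr (v _ _ _ _ (by linarith) (by linarith))),
      v _ _ _ _ (by congr 1; simp; linarith) (by congr 1; simp; linarith)⟩
  · exfalso; linarith
  · exact ⟨Or.inr (Or.inl (v _ _ _ _ (by linarith) (by linarith))),
      Or.inl (v _ _ _ _ (by linarith) (by linarith)),
      v _ _ _ _ (by congr 1; simp; linarith) (by congr 1; simp; linarith)⟩
  · exact ⟨Or.inl (v _ _ _ _ (by linarith) (by linarith)),
      Or.inr (Or.inr (v _ _ _ _ (by linarith) (by linarith))),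
      v _ _ _ _ (by congr 1; simp; linarith) (by congr 1; simp; linarith)⟩
  · exact ⟨Or.inr (Or.inr (v _ _ _ _ (by linarith) (by linarith))),
      Or.inl (v _ _ _ _ (by linarith) (by linarith)),
      v _ _ _ _ (by congr 1; simp; linarith) (by congr 1; simp; linarith)⟩
  · exact absurd rfl hij

lemma wordMap_congr (q : Fin 3 → E2) (l : ℕ → ℕ) {w v : ℕ → ℕ × ℕ} (n : ℕ)
    (h : ∀ k < n, w k = v k) : wordMap q l w n = wordMap q l v n := by
  induction n with
  | zero => rfl
  | succ n ih =>
    simp only [wordMap]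
    rw [ih (fun k hk => h k (by omega)), h n (by omega)]

lemma wordMap_add (q : Fin 3 → E2) (l : ℕ → ℕ) (w : ℕ → ℕ × ℕ) (k j : ℕ) (x : E2) :
    wordMap q l w (k + j) x =
      wordMap q l w k (wordMap q (fun i => l (k + i)) (fun i => w (k + i)) j x) := by
  induction j generalizing x with
  | zero => rfl
  | succ j ih => exact ih _

lemma wordMap_inj (q : Fin 3 → E2) (l : ℕ → ℕ) (hl : ∀ n, 5 ≤ l n) (w : ℕ → ℕ × ℕ) (n : ℕ) :
    Function.Injective (wordMap q l w n) := by
  induction n with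
  | zero => exact Function.injective_id
  | succ n ih => exact ih.comp (fmap_inj q (hl n) _)

lemma wordMap_Tri (q : Fin 3 → E2) (l : ℕ → ℕ) (hl : ∀ n, 5 ≤ l n) (w : ℕ → ℕ × ℕ) (n : ℕ)
    (hw : ∀ k < n, w k ∈ Sset (l k)) (x : E2) (hx : x ∈ Tri q) : wordMap q l w n x ∈ Tri q := by
  induction n generalizing x with
  | zero => exact hx
  | succ n ih =>
    exact ih (fun k hk => hw k (by omega)) _ (fmap_Tri q (hl n) (hw n (by omega)) hx)

lemma wordMap_V0 (q : Fin 3 → E2) (hq : ∀ j k : Fin 3, j ≠ k → dist (q j) (q k) = 1)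
    (l : ℕ → ℕ) (hl : ∀ n, 5 ≤ l n) (w : ℕ → ℕ × ℕ) (n : ℕ)
    (hw : ∀ k < n, w k ∈ Sset (l k)) (x : E2) (hx : x ∈ Tri q) (h : wordMap q l w n x ∈ V0 q) :
    x ∈ V0 q := by
  induction n generalizing x with
  | zero => exact h
  | succ n ih =>
    exact fmap_V0 q hq (hl n) (hw n (by omega)) hx
      (ih (fun k hk => hw k (by omega)) _ (fmap_Tri q (hl n) (hw n (by omega)) hx) h)

lemma corner (q : Fin 3 → E2) {l : ℕ} (hl : 5 ≤ l) {x : E2} (hx : x ∈ V0 q) :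
    ∃ i ∈ Sset l, fmap q l i x = x := by
  have h3 : (l : ℝ) ≠ 0 := by
    have : (0 : ℝ) < l := by exact_mod_cast (by omega : 0 < l)
    positivity
  have h4 : ((l - 1 : ℕ) : ℝ) + 1 = l := by exact_mod_cast (by omega : l - 1 + 1 = l)
  rw [mem_V0] at hx
  rcases hx with rfl | rfl | rfl
  · exact ⟨(0, 0), by simp [Sset], by simp [fmap_PP]⟩
  · exact ⟨(l - 1, 0), by simp [Sset], by rw [fmap_PP]; simp only [h4]; simp [h3]⟩
  · exact ⟨(0, l - 1), by simp [Sset], by rw [fmap_PP]; simp only [h4]; simp [h3]⟩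

lemma vertex_ext (q : Fin 3 → E2) (l : ℕ → ℕ) (hl : ∀ n, 5 ≤ l n) (w : ℕ → ℕ × ℕ) (n : ℕ)
    (hw : w ∈ Wn l n) (x : E2) (hx : x ∈ V0 q) (j : ℕ) :
    ∃ v ∈ Wn l (n + j), wordMap q l v (n + j) x = wordMap q l w n x := by
  induction j with
  | zero => exact ⟨w, hw, rfl⟩
  | succ j ih =>
    obtain ⟨v, hv, e⟩ := ih
    obtain ⟨i, hi, ei⟩ := corner q (hl (n + j)) hx
    refine ⟨Function.update v (n + j) i, ⟨?_, ?_⟩, ?_⟩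
    · intro k hk
      by_cases hkn : k = n + j
      · subst hkn; simpa using hi
      · rw [Function.update_of_ne hkn]; exact hv.1 k (by omega)
    · intro k hk
      rw [Function.update_of_ne (by omega)]; exact hv.2 k (by omega)
    · change wordMap q l _ (n + j) (fmap q (l (n + j)) (Function.update v (n + j) i (n + j)) x) = _
      rw [Function.update_self, ei, ← e,
        wordMap_congr q l (v := v) (n + j) (fun k hk => Function.update_of_ne (by omega) _ _)]

lemma vertex_Gasket (q : Fin 3 → E2) (l : ℕ → ℕ) (hl : ∀ n, 5 ≤ l n) (w : ℕ → ℕ × ℕ) (n : ℕ)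
    (hw : w ∈ Wn l n) (x : E2) (hx : x ∈ V0 q) : wordMap q l w n x ∈ Gasket q l := by
  simp only [Gasket, mem_iInter, mem_iUnion, exists_prop]
  intro N
  rcases le_total n N with h | h
  · obtain ⟨j, rfl⟩ := Nat.exists_eq_add_of_le h
    obtain ⟨v, hv, e⟩ := vertex_ext q l hl w n hw x hx j
    exact ⟨v, hv, x, V0_sub_Tri q hx, e⟩
  · obtain ⟨j, rfl⟩ := Nat.exists_eq_add_of_le h
    refine ⟨fun k => if k < N then w k else (0, 0), ⟨?_, ?_⟩,
      wordMap q (fun i => l (N + i)) (fun i => w (N + i)) j x, ?_, ?_⟩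
    · intro k hk; simpa [hk] using hw.1 k (by omega)
    · intro k hk; simp [hk]
    · exact wordMap_Tri q _ (fun i => hl _) _ _ (fun k hk => hw.1 _ (by omega)) _ (V0_sub_Tri q hx)
    · rw [wordMap_add, wordMap_congr q l (v := w) N (fun k hk => by simp [hk])]

lemma main_aux (q : Fin 3 → E2) (hq : ∀ j k : Fin 3, j ≠ k → dist (q j) (q k) = 1)
    (l : ℕ → ℕ) (hl : ∀ n, 5 ≤ l n) (n m : ℕ)
    (w v : ℕ → ℕ × ℕ) (hw : w ∈ Wn l n) (hv : v ∈ Wn l m)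
    (k : ℕ) (hk : k < min n m) (hne : w k ≠ v k) :
    ∃ p : E2, ∀ x ∈ Tri q, ∀ y ∈ Tri q, wordMap q l w n x = wordMap q l v m y →
      x ∈ V0 q ∧ y ∈ V0 q ∧ wordMap q l w n x = p := by
  classical
  have hex : ∃ k, w k ≠ v k := ⟨k, hne⟩
  have hmin : ∀ i < Nat.find hex, w i = v i := fun i hi => by
    simpa using Nat.find_min hex hi
  have hr := Nat.find_spec hex
  have hrk : Nat.find hex ≤ k := Nat.find_min' hex hne
  generalize Nat.find hex = r at *
  obtain ⟨n', rfl⟩ := Nat.exists_eq_add_of_le (show r + 1 ≤ n by omega)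
  obtain ⟨m', rfl⟩ := Nat.exists_eq_add_of_le (show r + 1 ≤ m by omega)
  obtain ⟨p, hp⟩ := core q hq (hl r) hr
  refine ⟨wordMap q l w r p, fun x hx y hy h => ?_⟩
  rw [wordMap_add q l w (r + 1), wordMap_add q l v (r + 1)] at h
  rw [wordMap_add q l w (r + 1)]
  have hx' := wordMap_Tri q (fun i => l (r + 1 + i)) (fun i => hl _) (fun i => w (r + 1 + i)) n'
    (fun k hk => hw.1 _ (by omega)) x hx
  have hy' := wordMap_Tri q (fun i => l (r + 1 + i)) (fun i => hl _) (fun i => v (r + 1 + i)) m'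
    (fun k hk => hv.1 _ (by omega)) y hy
  simp only [wordMap, Function.comp_apply] at h ⊢
  rw [← wordMap_congr q l r hmin] at h
  obtain ⟨h1, h2, h3⟩ := hp _ hx' _ hy' (wordMap_inj q l hl w r h)
  exact ⟨wordMap_V0 q hq _ (fun i => hl _) _ _ (fun k hk => hw.1 _ (by omega)) x hx h1,
    wordMap_V0 q hq _ (fun i => hl _) _ _ (fun k hk => hv.1 _ (by omega)) y hy h2, by rw [h3]⟩

/-- If two nonempty words differ at some common position, then the
corresponding cells intersect in at most one point, and
`f_w(△) ∩ f_v(△) = K_w ∩ K_v = f_w(V₀) ∩ f_v(V₀)`. -/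
theorem stmt0 (q : Fin 3 → E2) (hq : ∀ j k : Fin 3, j ≠ k → dist (q j) (q k) = 1)
    (l : ℕ → ℕ) (hl : ∀ n, 5 ≤ l n)
    (n m : ℕ) (hn : 1 ≤ n) (hm : 1 ≤ m)
    (w v : ℕ → ℕ × ℕ) (hw : w ∈ Wn l n) (hv : v ∈ Wn l m)
    (k : ℕ) (hk : k < min n m) (hne : w k ≠ v k) :
    (Cell q l n w ∩ Cell q l m v).Subsingleton ∧
    wordMap q l w n '' Tri q ∩ wordMap q l v m '' Tri q = Cell q l n w ∩ Cell q l m v ∧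
    Cell q l n w ∩ Cell q l m v =
      wordMap q l w n '' V0 q ∩ wordMap q l v m '' V0 q := by
  obtain ⟨p, hp⟩ := main_aux q hq l hl n m w v hw hv k hk hne
  have sub1 : wordMap q l w n '' Tri q ∩ wordMap q l v m '' Tri q ⊆
      wordMap q l w n '' V0 q ∩ wordMap q l v m '' V0 q := by
    rintro _ ⟨⟨x, hx, rfl⟩, y, hy, e⟩
    obtain ⟨h1, h2, _⟩ := hp x hx y hy e.symm
    exact ⟨⟨x, h1, rfl⟩, y, h2, e⟩
  have sub2 : wordMap q l w n '' V0 q ∩ wordMap q l v m '' V0 q ⊆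
      Cell q l n w ∩ Cell q l m v := by
    rintro _ ⟨⟨x, hx, rfl⟩, y, hy, e⟩
    have hg := vertex_Gasket q l hl w n hw x hx
    exact ⟨⟨hg, x, V0_sub_Tri q hx, rfl⟩, hg, y, V0_sub_Tri q hy, e⟩
  have sub3 : Cell q l n w ∩ Cell q l m v ⊆
      wordMap q l w n '' Tri q ∩ wordMap q l v m '' Tri q :=
    fun _ hx => ⟨hx.1.2, hx.2.2⟩
  refine ⟨?_, (sub1.trans sub2).antisymm sub3, (sub3.trans sub1).antisymm sub2⟩
  have hs : ∀ z ∈ Cell q l n w ∩ Cell q l m v, z = p := by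
    rintro _ ⟨⟨_, x, hx, rfl⟩, _, y, hy, e⟩
    exact (hp x hx y hy e.symm).2.2
  intro a ha b hb
  rw [hs a ha, hs b hb]
end
end

section
/- The function d is a metric on K; it is geodesic, i.e., for any x,y ∈ K there exists a continuous γ : [0,1] → K with γ(0)=x, γ(1)=y and d(γ(s),γ(t)) = |s−t|·d(x,y) for all s,t ∈ [0,1]; and |x−y| ≤ d(x,y) ≤ 6|x−y| for any x,y ∈ K, where |·| is the Euclidean norm. -/
open scoped BigOperators ENNReal
open Set Filter MeasureTheory

noncomputable section

/-- `x` and `y` are joined in `K` by a 1-Lipschitz path of duration `T`. -/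
def JJ (K : Set E2) (x y : E2) (T : ℝ) : Prop :=
  0 ≤ T ∧ ∃ γ : ℝ → E2, (∀ t ∈ Set.Icc 0 T, γ t ∈ K) ∧
    (∀ s ∈ Set.Icc 0 T, ∀ t ∈ Set.Icc 0 T, dist (γ s) (γ t) ≤ |s - t|) ∧ γ 0 = x ∧ γ T = y

theorem JJ.refl {K : Set E2} {x : E2} (hx : x ∈ K) {T : ℝ} (hT : 0 ≤ T) : JJ K x x T :=
  ⟨hT, fun _ => x, fun _ _ => hx, fun _ _ _ _ => by simp, rfl, rfl⟩

theorem JJ.symm {K : Set E2} {x y : E2} {T : ℝ} (h : JJ K x y T) : JJ K y x T := by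
  obtain ⟨hT, γ, h1, h2, h3, h4⟩ := h
  refine ⟨hT, fun t => γ (T - t), ?_, ?_, by simpa using h4, by simpa using h3⟩
  · rintro t ⟨ht0, ht1⟩
    exact h1 _ ⟨by linarith, by linarith⟩
  · rintro s ⟨hs0, hs1⟩ t ⟨ht0, ht1⟩
    refine (h2 _ ⟨by linarith, by linarith⟩ _ ⟨by linarith, by linarith⟩).trans ?_
    rw [show T - s - (T - t) = -(s - t) by ring, abs_neg]

theorem JJ.trans {K : Set E2} {x y z : E2} {T U : ℝ} (h : JJ K x y T) (h' : JJ K y z U) :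
    JJ K x z (T + U) := by
  obtain ⟨hT, γ, h1, h2, h3, h4⟩ := h
  obtain ⟨hU, δ, k1, k2, k3, k4⟩ := h'
  have key : ∀ s ∈ Set.Icc (0:ℝ) T, ∀ t ∈ Set.Icc T (T + U),
      dist (γ s) (δ (t - T)) ≤ |s - t| := by
    rintro s ⟨hs0, hs1⟩ t ⟨ht0, ht1⟩
    have e1 := h2 s ⟨hs0, hs1⟩ T ⟨hT, le_rfl⟩
    have e2 := k2 0 ⟨le_rfl, hU⟩ (t - T) ⟨by linarith, by linarith⟩
    rw [h4] at e1
    rw [k3] at e2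
    have := dist_triangle (γ s) y (δ (t - T))
    rw [abs_of_nonpos (by linarith)] at e1 e2 ⊢
    linarith
  refine ⟨by linarith, fun t => if t ≤ T then γ t else δ (t - T), ?_, ?_, ?_, ?_⟩
  · rintro t ⟨ht0, ht1⟩
    dsimp only
    split_ifs with h
    · exact h1 _ ⟨ht0, h⟩
    · exact k1 _ ⟨by linarith, by linarith⟩
  · rintro s ⟨hs0, hs1⟩ t ⟨ht0, ht1⟩
    dsimp only
    split_ifs with h h' h'
    · exact h2 _ ⟨hs0, h⟩ _ ⟨ht0, h'⟩
    · exact key _ ⟨hs0, h⟩ _ ⟨by linarith, ht1⟩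
    · rw [dist_comm, abs_sub_comm]
      exact key _ ⟨ht0, h'⟩ _ ⟨by linarith, hs1⟩
    · refine (k2 _ ⟨by linarith, by linarith⟩ _ ⟨by linarith, by linarith⟩).trans ?_
      rw [show s - T - (t - T) = s - t by ring]
  · simp [hT, h3]
  · dsimp only
    split_ifs with h
    · have : U = 0 := by linarith
      subst this
      rw [add_zero, h4, ← k3, k4]
    · simpa using k4

theorem JJ.right_mem {K : Set E2} {x y : E2} {T : ℝ} (h : JJ K x y T) : y ∈ K := by
  obtain ⟨hT, γ, h1, h2, h3, h4⟩ := h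
  exact h4 ▸ h1 T ⟨hT, le_rfl⟩

theorem JJ.mono {K : Set E2} {x y : E2} {T U : ℝ} (h : JJ K x y T) (hTU : T ≤ U) :
    JJ K x y U := by
  have := h.trans (JJ.refl h.right_mem (sub_nonneg.2 hTU))
  simpa using this

theorem JJ.map {K K' : Set E2} {x y : E2} {T c : ℝ} (h : JJ K x y T) (hc : 0 < c)
    (f : E2 → E2) (hf : ∀ x ∈ K, f x ∈ K') (hd : ∀ x y, dist (f x) (f y) = c * dist x y) :
    JJ K' (f x) (f y) (c * T) := by
  obtain ⟨hT, γ, h1, h2, h3, h4⟩ := h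
  have aux : ∀ t ∈ Set.Icc 0 (c * T), t / c ∈ Set.Icc 0 T := by
    rintro t ⟨h0, h1⟩
    exact ⟨by positivity, by rw [div_le_iff₀ hc]; linarith⟩
  refine ⟨by positivity, fun t => f (γ (t / c)), ?_, ?_, by simp [h3], ?_⟩
  · exact fun t ht => hf _ (h1 _ (aux t ht))
  · intro s hs t ht
    rw [hd]
    have := h2 _ (aux s hs) _ (aux t ht)
    rw [← sub_div, abs_div, abs_of_pos hc, le_div_iff₀ hc] at this
    linarith
  · simp only [mul_div_cancel_left₀ _ hc.ne', h4]

theorem JJ.seg {K : Set E2} {x y : E2}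
    (h : ∀ t ∈ Set.Icc (0:ℝ) 1, x + t • (y - x) ∈ K) : JJ K x y (dist x y) := by
  by_cases hxy : x = y
  · subst hxy
    exact JJ.refl (by simpa using h 0 (by simp)) dist_nonneg
  have hd : 0 < dist x y := dist_pos.2 hxy
  refine ⟨hd.le, fun t => x + (t / dist x y) • (y - x), ?_, ?_, by simp, ?_⟩
  · rintro t ⟨h0, h1⟩
    exact h _ ⟨by positivity, by rw [div_le_one hd]; exact h1⟩
  · intro s _ t _
    rw [dist_add_left, dist_eq_norm, ← sub_smul, norm_smul, ← sub_div, Real.norm_eq_abs, abs_div,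
      abs_of_pos hd, ← dist_eq_norm, dist_comm y x, div_mul_cancel₀ _ hd.ne']
  · simp [div_self hd.ne']

theorem JJ.limit {K : Set E2} (hK : IsCompact K) {x y : E2} {T : ℝ} (u : ℕ → E2)
    (hu : Tendsto u atTop (nhds x)) (h : ∀ n, JJ K (u n) y T) : JJ K x y T := by
  have hT := (h 0).1
  choose h0 γ h1 h2 h3 h4 using h
  let U : Ultrafilter ℕ := Filter.hyperfilter ℕ
  have hU : (U : Filter ℕ) ≤ atTop := by
    rw [← Nat.cofinite_eq_atTop]; exact Filter.hyperfilter_le_cofinite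
  have ex : ∀ t, ∃ z, t ∈ Set.Icc 0 T → z ∈ K ∧ Tendsto (fun n => γ n t) U (nhds z) := by
    intro t
    by_cases ht : t ∈ Set.Icc 0 T
    · obtain ⟨z, hz, hz'⟩ := hK.ultrafilter_le_nhds (U.map (fun n => γ n t)) (by
        rw [le_principal_iff]
        exact Filter.mem_map.2 (Filter.Eventually.of_forall (fun n => h1 n t ht)))
      exact ⟨z, fun _ => ⟨hz, hz'⟩⟩
    · exact ⟨x, fun h => absurd h ht⟩
  choose δ hδ using ex
  refine ⟨hT, δ, fun t ht => (hδ t ht).1, fun s hs t ht => ?_, ?_, ?_⟩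
  · exact le_of_tendsto ((hδ s hs).2.dist (hδ t ht).2)
      (Filter.Eventually.of_forall fun n => h2 n s hs t ht)
  · have := (hδ 0 ⟨le_rfl, hT⟩).2
    simp only [h3] at this
    exact tendsto_nhds_unique this (hu.mono_left hU)
  · have := (hδ T ⟨hT, le_rfl⟩).2
    simp only [h4] at this
    exact tendsto_nhds_unique this tendsto_const_nhds

theorem pdist_le_path (q : Fin 3 → E2) (l : ℕ → ℕ) (γ : ℝ → E2) {a b : ℝ} (hab : a ≤ b)
    (hc : ContinuousOn γ (Set.Icc a b)) (hm : ∀ t ∈ Set.Icc a b, γ t ∈ Gasket q l) :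
    pdist q l (γ a) (γ b) ≤ eVariationOn γ (Set.Icc a b) := by
  have hmaps : Set.MapsTo (fun t : ℝ => a + t * (b - a)) (Set.Icc 0 1) (Set.Icc a b) := by
    rintro t ⟨h0, h1⟩
    constructor <;> dsimp only <;> nlinarith
  have hle : eVariationOn (γ ∘ fun t : ℝ => a + t * (b - a)) (Set.Icc 0 1)
      ≤ eVariationOn γ (Set.Icc a b) := by
    refine eVariationOn.comp_le_of_monotoneOn γ _ ?_ hmaps
    intro s _ t _ hst
    dsimp only
    nlinarith
  refine le_trans ?_ hle
  unfold pdist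
  refine iInf_le_of_le (γ ∘ fun t : ℝ => a + t * (b - a)) ?_
  refine iInf_le_of_le (hc.comp (by fun_prop) hmaps) ?_
  refine iInf_le_of_le (fun t ht => hm _ (hmaps ht)) ?_
  refine iInf_le_of_le (by simp) ?_
  exact iInf_le_of_le (by simp) le_rfl

theorem exists_path_of_pdist_lt (q : Fin 3 → E2) (l : ℕ → ℕ) {x y : E2} {D : ℝ≥0∞}
    (h : pdist q l x y < D) : ∃ γ : ℝ → E2, ContinuousOn γ (Set.Icc 0 1) ∧
      (∀ t ∈ Set.Icc (0:ℝ) 1, γ t ∈ Gasket q l) ∧ γ 0 = x ∧ γ 1 = y ∧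
      eVariationOn γ (Set.Icc 0 1) < D := by
  unfold pdist at h
  simp only [iInf_lt_iff] at h
  obtain ⟨γ, h1, h2, h3, h4, h5⟩ := h
  exact ⟨γ, h1, h2, h3, h4, h5⟩

theorem pdist_le_of_JJ (q : Fin 3 → E2) (l : ℕ → ℕ) {x y : E2} {T : ℝ}
    (h : JJ (Gasket q l) x y T) : pdist q l x y ≤ ENNReal.ofReal T := by
  obtain ⟨hT, γ, h1, h2, h3, h4⟩ := h
  have hL : LipschitzOnWith 1 γ (Set.Icc 0 T) := by
    refine LipschitzOnWith.of_dist_le_mul fun s hs t ht => ?_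
    simpa [Real.dist_eq] using h2 s hs t ht
  have := pdist_le_path q l γ hT hL.continuousOn h1
  rw [h3, h4] at this
  refine this.trans ?_
  have h5 := hL.comp_eVariationOn_le (f := γ) (g := (id : ℝ → ℝ)) (s := Set.Icc 0 T)
    (fun t ht => ht)
  rw [Function.comp_id] at h5
  refine h5.trans ?_
  have h6 := (monotoneOn_id (s := Set.Icc (0:ℝ) T)).eVariationOn_eq (a := 0) (b := T)
    ⟨le_rfl, hT⟩ ⟨hT, le_rfl⟩
  rw [Set.inter_self] at h6
  rw [h6]
  simp

theorem edist_le_pdist (q : Fin 3 → E2) (l : ℕ → ℕ) (x y : E2) :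
    ENNReal.ofReal (dist x y) ≤ pdist q l x y := by
  unfold pdist
  refine le_iInf fun γ => le_iInf fun _ => le_iInf fun _ => le_iInf fun h0 => le_iInf fun h1 => ?_
  rw [← edist_dist, ← h0, ← h1]
  exact eVariationOn.edist_le γ (by simp) (by simp)

theorem pdist_symm_le (q : Fin 3 → E2) (l : ℕ → ℕ) (x y : E2) :
    pdist q l x y ≤ pdist q l y x := by
  refine le_of_forall_gt fun D hD => ?_
  obtain ⟨γ, h1, h2, h3, h4, h5⟩ := exists_path_of_pdist_lt q l hD
  have hmaps : Set.MapsTo (fun t : ℝ => 1 - t) (Set.Icc 0 1) (Set.Icc 0 1) := by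
    rintro t ⟨h0, h1⟩
    constructor <;> dsimp only <;> linarith
  have := pdist_le_path q l (γ ∘ fun t : ℝ => 1 - t) zero_le_one
    (h1.comp (by fun_prop) hmaps) (fun t ht => h2 _ (hmaps ht))
  simp only [Function.comp, sub_zero, sub_self, h3, h4] at this
  refine (this.trans ?_).trans_lt h5
  refine eVariationOn.comp_le_of_antitoneOn γ (fun t : ℝ => 1 - t) ?_ hmaps
  intro s _ t _ hst
  dsimp only
  linarith

theorem pdist_symm (q : Fin 3 → E2) (l : ℕ → ℕ) (x y : E2) :
    pdist q l x y = pdist q l y x :=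
  le_antisymm (pdist_symm_le q l x y) (pdist_symm_le q l y x)

theorem pdist_triangle (q : Fin 3 → E2) (l : ℕ → ℕ) (x y z : E2) :
    pdist q l x z ≤ pdist q l x y + pdist q l y z := by
  refine ENNReal.le_of_forall_pos_le_add fun ε hε hfin => ?_
  have hε2 : (ε / 2 : ℝ≥0∞) ≠ 0 := by
    simp [hε.ne']
  obtain ⟨γ, h1, h2, h3, h4, h5⟩ := exists_path_of_pdist_lt q l
    (ENNReal.lt_add_right (lt_of_le_of_lt le_self_add hfin).ne hε2)
  obtain ⟨δ, k1, k2, k3, k4, k5⟩ := exists_path_of_pdist_lt q l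
    (ENNReal.lt_add_right (lt_of_le_of_lt le_add_self hfin).ne hε2)
  let ρ : ℝ → E2 := fun t => if t ≤ 1 then γ t else δ (t - 1)
  have e1 : Set.EqOn ρ γ (Set.Icc 0 1) := fun t ht => if_pos ht.2
  have hmaps : Set.MapsTo (fun t : ℝ => t - 1) (Set.Icc 1 2) (Set.Icc 0 1) := by
    rintro t ⟨h0, h1⟩
    constructor <;> dsimp only <;> linarith
  have e2 : Set.EqOn ρ (δ ∘ fun t : ℝ => t - 1) (Set.Icc 1 2) := by
    rintro t ⟨ht, _⟩
    by_cases h : t ≤ 1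
    · have : t = 1 := le_antisymm h ht
      subst this
      simp [ρ, h4, k3]
    · simp [ρ, h]
  have un : Set.Icc (0:ℝ) 1 ∪ Set.Icc 1 2 = Set.Icc 0 2 :=
    Set.Icc_union_Icc_eq_Icc (by norm_num) (by norm_num)
  have hc : ContinuousOn ρ (Set.Icc 0 2) := by
    rw [← un]
    refine ContinuousOn.union_of_isClosed (h1.congr e1) ?_ isClosed_Icc isClosed_Icc
    exact (k1.comp (by fun_prop) hmaps).congr e2
  have hm : ∀ t ∈ Set.Icc (0:ℝ) 2, ρ t ∈ Gasket q l := by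
    rw [← un]
    rintro t (ht | ht)
    · rw [e1 ht]; exact h2 t ht
    · rw [e2 ht]; exact k2 _ (hmaps ht)
  have fin := pdist_le_path q l ρ (by norm_num) hc hm
  rw [show ρ 0 = x by simp [ρ, h3], show ρ 2 = z by
    rw [e2 ⟨by norm_num, le_rfl⟩]; norm_num [k4]] at fin
  rw [← un, eVariationOn.union ρ (isGreatest_Icc zero_le_one) (isLeast_Icc (by norm_num)),
    eVariationOn.congr e1, eVariationOn.congr e2] at fin
  have v2 : eVariationOn (δ ∘ fun t : ℝ => t - 1) (Set.Icc 1 2) ≤ eVariationOn δ (Set.Icc 0 1) := by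
    refine eVariationOn.comp_le_of_monotoneOn δ (fun t : ℝ => t - 1) ?_ hmaps
    intro s _ t _ hst
    dsimp only
    linarith
  calc pdist q l x z ≤ _ := fin
    _ ≤ (pdist q l x y + ε / 2) + (pdist q l y z + ε / 2) :=
        add_le_add h5.le (v2.trans k5.le)
    _ = pdist q l x y + pdist q l y z + (ε / 2 + ε / 2) := by abel
    _ = _ := by rw [ENNReal.add_halves]


theorem approx_geod (q : Fin 3 → E2) (l : ℕ → ℕ)
    (h6 : ∀ x ∈ Gasket q l, ∀ y ∈ Gasket q l, pdist q l x y ≤ ENNReal.ofReal (6 * dist x y))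
    {x y : E2} (hx : x ∈ Gasket q l) (hy : y ∈ Gasket q l) {ε : ℝ} (hε : 0 < ε) :
    ∃ γ : ℝ → E2, (∀ t ∈ Set.Icc (0:ℝ) 1, γ t ∈ Gasket q l) ∧
      (∀ t ∈ Set.Icc (0:ℝ) 1, gdist q l x (γ t) = t * gdist q l x y) ∧
      (∀ s ∈ Set.Icc (0:ℝ) 1, ∀ t ∈ Set.Icc (0:ℝ) 1,
        gdist q l (γ s) (γ t) ≤ |s - t| * gdist q l x y + ε) ∧
      gdist q l (γ 1) y ≤ ε := by
  have fin : ∀ x ∈ Gasket q l, ∀ y ∈ Gasket q l, pdist q l x y ≠ ⊤ := fun x hx y hy =>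
    ((h6 x hx y hy).trans_lt ENNReal.ofReal_lt_top).ne
  have tri : ∀ x ∈ Gasket q l, ∀ y ∈ Gasket q l, ∀ z ∈ Gasket q l,
      gdist q l x z ≤ gdist q l x y + gdist q l y z := by
    intro x hx y hy z hz
    unfold gdist
    rw [← ENNReal.toReal_add (fin x hx y hy) (fin y hy z hz)]
    exact ENNReal.toReal_mono (ENNReal.add_ne_top.2 ⟨fin x hx y hy, fin y hy z hz⟩)
      (pdist_triangle q l x y z)
  have sym : ∀ x y, gdist q l x y = gdist q l y x := fun x y => by
    unfold gdist; rw [pdist_symm]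
  have g6 : ∀ x ∈ Gasket q l, ∀ y ∈ Gasket q l, gdist q l x y ≤ 6 * dist x y := by
    intro x hx y hy
    exact ENNReal.toReal_le_of_le_ofReal (by positivity) (h6 x hx y hy)
  obtain ⟨γ, h1, h2, h3, h4, h5⟩ := exists_path_of_pdist_lt q l
    (ENNReal.lt_add_right (fin x hx y hy) (b := ENNReal.ofReal ε) (by simpa using hε))
  have split3 : ∀ r r', 0 ≤ r → r ≤ r' → r' ≤ 1 →
      gdist q l x (γ r) + gdist q l (γ r) (γ r') + gdist q l (γ r') y ≤ gdist q l x y + ε := by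
    intro r r' h0 hr hr1
    have m0 : x ∈ Gasket q l := hx
    have m1 : γ r ∈ Gasket q l := h2 _ ⟨h0, hr.trans hr1⟩
    have m2 : γ r' ∈ Gasket q l := h2 _ ⟨h0.trans hr, hr1⟩
    have s1 : Set.Icc 0 r ⊆ Set.Icc (0:ℝ) 1 := Set.Icc_subset_Icc le_rfl (hr.trans hr1)
    have s2 : Set.Icc r r' ⊆ Set.Icc (0:ℝ) 1 := Set.Icc_subset_Icc h0 hr1
    have s3 : Set.Icc r' 1 ⊆ Set.Icc (0:ℝ) 1 := Set.Icc_subset_Icc (h0.trans hr) le_rfl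
    have p1 := pdist_le_path q l γ h0 (h1.mono s1) (fun t ht => h2 t (s1 ht))
    have p2 := pdist_le_path q l γ hr (h1.mono s2) (fun t ht => h2 t (s2 ht))
    have p3 := pdist_le_path q l γ hr1 (h1.mono s3) (fun t ht => h2 t (s3 ht))
    rw [h3] at p1
    rw [h4] at p3
    have v : eVariationOn γ (Set.Icc 0 r) + eVariationOn γ (Set.Icc r r')
        + eVariationOn γ (Set.Icc r' 1) = eVariationOn γ (Set.Icc 0 1) := by
      have a1 := eVariationOn.Icc_add_Icc γ (s := Set.univ) h0 hr (Set.mem_univ _)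
      have a2 := eVariationOn.Icc_add_Icc γ (s := Set.univ) (h0.trans hr) hr1 (Set.mem_univ _)
      simp only [Set.univ_inter] at a1 a2
      rw [a1, a2]
    have tot : pdist q l x (γ r) + pdist q l (γ r) (γ r') + pdist q l (γ r') y
        ≤ pdist q l x y + ENNReal.ofReal ε :=
      (add_le_add (add_le_add p1 p2) p3).trans (v.le.trans h5.le)
    have n1 := fin x hx _ m1
    have n2 := fin _ m1 _ m2
    have n3 := fin _ m2 y hy
    have := ENNReal.toReal_mono (ENNReal.add_ne_top.2 ⟨fin x hx y hy, ENNReal.ofReal_ne_top⟩) tot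
    rw [ENNReal.toReal_add (ENNReal.add_ne_top.2 ⟨n1, n2⟩) n3, ENNReal.toReal_add n1 n2,
      ENNReal.toReal_add (fin x hx y hy) ENNReal.ofReal_ne_top, ENNReal.toReal_ofReal hε.le] at this
    exact this
  have hself : gdist q l x x = 0 := by
    have := g6 x hx x hx
    rw [dist_self, mul_zero] at this
    exact le_antisymm this ENNReal.toReal_nonneg
  have hcont : ContinuousOn (fun r => gdist q l x (γ r)) (Set.Icc 0 1) := by
    have : ContinuousOn (fun z => gdist q l x z) (Gasket q l) := by
      have : LipschitzOnWith 6 (fun z => gdist q l x z) (Gasket q l) := by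
        refine LipschitzOnWith.of_dist_le_mul fun z hz w hw => ?_
        rw [Real.dist_eq, abs_le]
        have e1 := tri x hx z hz w hw
        have e2 := tri x hx w hw z hz
        have e3 := g6 z hz w hw
        rw [sym w z] at e2
        constructor <;> norm_num <;> linarith
      exact this.continuousOn
    exact this.comp h1 h2
  have ivt : ∀ t ∈ Set.Icc (0:ℝ) 1, ∃ r ∈ Set.Icc (0:ℝ) 1,
      gdist q l x (γ r) = t * gdist q l x y := by
    rintro t ⟨ht0, ht1⟩
    have D0 : 0 ≤ gdist q l x y := ENNReal.toReal_nonneg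
    have := intermediate_value_Icc zero_le_one hcont
    obtain ⟨r, hr, hr'⟩ := this (show t * gdist q l x y ∈ _ from by
      simp only [h3, h4, hself]
      constructor
      · positivity
      · nlinarith)
    exact ⟨r, hr, hr'⟩
  choose! r hr hrd using ivt
  have low : ∀ t ∈ Set.Icc (0:ℝ) 1, (1 - t) * gdist q l x y ≤ gdist q l (γ (r t)) y := by
    intro t ht
    have := tri x hx _ (h2 _ (hr t ht)) y hy
    rw [hrd t ht] at this
    linarith
  have key : ∀ s ∈ Set.Icc (0:ℝ) 1, ∀ t ∈ Set.Icc (0:ℝ) 1, r s ≤ r t →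
      gdist q l (γ (r s)) (γ (r t)) ≤ |s - t| * gdist q l x y + ε := by
    intro s hs t ht hst
    have e := split3 _ _ (hr s hs).1 hst (hr t ht).2
    rw [hrd s hs] at e
    have e2 := low t ht
    have D0 : 0 ≤ gdist q l x y := ENNReal.toReal_nonneg
    have e3 : (t - s) * gdist q l x y ≤ |s - t| * gdist q l x y := by
      rw [abs_sub_comm]
      exact mul_le_mul_of_nonneg_right (le_abs_self _) D0
    linarith
  refine ⟨fun t => γ (r t), fun t ht => h2 _ (hr t ht), hrd, ?_, ?_⟩
  · intro s hs t ht
    rcases le_total (r s) (r t) with h | h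
    · exact key s hs t ht h
    · rw [sym, abs_sub_comm]
      exact key t ht s hs h
  · have one : (1:ℝ) ∈ Set.Icc (0:ℝ) 1 := ⟨zero_le_one, le_rfl⟩
    have e := split3 _ _ (hr 1 one).1 (hr 1 one).2 le_rfl
    have e1 := hrd 1 one
    have e2 := tri _ (h2 _ (hr 1 one)) _ hy _ hy
    have e3 : gdist q l (γ 1) y = 0 := by
      rw [h4]
      have := g6 y hy y hy
      rw [dist_self, mul_zero] at this
      exact le_antisymm this ENNReal.toReal_nonneg
    rw [e1, e3, h4] at e
    linarith

theorem geod_exists (q : Fin 3 → E2) (l : ℕ → ℕ) (hK : IsCompact (Gasket q l))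
    (h6 : ∀ x ∈ Gasket q l, ∀ y ∈ Gasket q l, pdist q l x y ≤ ENNReal.ofReal (6 * dist x y))
    {x y : E2} (hx : x ∈ Gasket q l) (hy : y ∈ Gasket q l) :
    ∃ γ : ℝ → E2,
      ContinuousOn γ (Set.Icc 0 1) ∧ Set.MapsTo γ (Set.Icc 0 1) (Gasket q l) ∧
      γ 0 = x ∧ γ 1 = y ∧
      ∀ s ∈ Set.Icc (0:ℝ) 1, ∀ t ∈ Set.Icc (0:ℝ) 1,
        pdist q l (γ s) (γ t) = ENNReal.ofReal |s - t| * pdist q l x y := by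
  have fin : ∀ x ∈ Gasket q l, ∀ y ∈ Gasket q l, pdist q l x y ≠ ⊤ := fun x hx y hy =>
    ((h6 x hx y hy).trans_lt ENNReal.ofReal_lt_top).ne
  have tri : ∀ x ∈ Gasket q l, ∀ y ∈ Gasket q l, ∀ z ∈ Gasket q l,
      gdist q l x z ≤ gdist q l x y + gdist q l y z := by
    intro x hx y hy z hz
    unfold gdist
    rw [← ENNReal.toReal_add (fin x hx y hy) (fin y hy z hz)]
    exact ENNReal.toReal_mono (ENNReal.add_ne_top.2 ⟨fin x hx y hy, fin y hy z hz⟩)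
      (pdist_triangle q l x y z)
  have sym : ∀ x y, gdist q l x y = gdist q l y x := fun x y => by
    unfold gdist; rw [pdist_symm]
  have g6 : ∀ x ∈ Gasket q l, ∀ y ∈ Gasket q l, gdist q l x y ≤ 6 * dist x y := by
    intro x hx y hy
    exact ENNReal.toReal_le_of_le_ofReal (by positivity) (h6 x hx y hy)
  have g1 : ∀ x ∈ Gasket q l, ∀ y ∈ Gasket q l, dist x y ≤ gdist q l x y := by
    intro x hx y hy
    exact (ENNReal.ofReal_le_iff_le_toReal (fin x hx y hy)).1 (edist_le_pdist q l x y)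
  have D0 : 0 ≤ gdist q l x y := ENNReal.toReal_nonneg
  have ap := fun n : ℕ => approx_geod q l h6 hx hy (ε := 1 / ((n : ℝ) + 1)) (by positivity)
  choose γ h1 h2 h3 h4 using ap
  let U : Ultrafilter ℕ := Filter.hyperfilter ℕ
  have hU : (U : Filter ℕ) ≤ atTop := by
    rw [← Nat.cofinite_eq_atTop]; exact Filter.hyperfilter_le_cofinite
  have hε : Tendsto (fun n : ℕ => 1 / ((n : ℝ) + 1)) U (nhds 0) :=
    tendsto_one_div_add_atTop_nhds_zero_nat.mono_left hU
  have ex : ∀ t, ∃ z, t ∈ Set.Icc (0:ℝ) 1 →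
      z ∈ Gasket q l ∧ Tendsto (fun n => γ n t) U (nhds z) := by
    intro t
    by_cases ht : t ∈ Set.Icc (0:ℝ) 1
    · obtain ⟨z, hz, hz'⟩ := hK.ultrafilter_le_nhds (U.map (fun n => γ n t)) (by
        rw [le_principal_iff]
        exact Filter.mem_map.2 (Filter.Eventually.of_forall (fun n => h1 n t ht)))
      exact ⟨z, fun _ => ⟨hz, hz'⟩⟩
    · exact ⟨x, fun h => absurd h ht⟩
  choose δ hδ using ex
  have zero : (0:ℝ) ∈ Set.Icc (0:ℝ) 1 := ⟨le_rfl, zero_le_one⟩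
  have one : (1:ℝ) ∈ Set.Icc (0:ℝ) 1 := ⟨zero_le_one, le_rfl⟩
  have d0 : δ 0 = x := by
    refine tendsto_nhds_unique (hδ 0 zero).2 ?_
    have : (fun n => γ n 0) = fun _ => x := by
      funext n
      have e := h2 n 0 zero
      have e' := g1 x hx _ (h1 n 0 zero)
      rw [e, zero_mul] at e'
      exact (dist_le_zero.1 e').symm
    rw [this]
    exact tendsto_const_nhds
  have d1 : δ 1 = y := by
    refine tendsto_nhds_unique (hδ 1 one).2 ?_
    rw [tendsto_iff_dist_tendsto_zero]
    exact squeeze_zero (fun _ => dist_nonneg)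
      (fun n => (g1 _ (h1 n 1 one) y hy).trans (h4 n)) hε
  have up : ∀ s ∈ Set.Icc (0:ℝ) 1, ∀ t ∈ Set.Icc (0:ℝ) 1,
      gdist q l (δ s) (δ t) ≤ |s - t| * gdist q l x y := by
    intro s hs t ht
    have es := (tendsto_iff_dist_tendsto_zero.1 (hδ s hs).2).const_mul 6
    have et := (tendsto_iff_dist_tendsto_zero.1 (hδ t ht).2).const_mul 6
    have lim : Tendsto (fun n : ℕ => 6 * dist (γ n s) (δ s) + 6 * dist (γ n t) (δ t) +
        (|s - t| * gdist q l x y + 1 / ((n : ℝ) + 1))) U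
        (nhds (6 * 0 + 6 * 0 + (|s - t| * gdist q l x y + 0))) :=
      (es.add et).add (tendsto_const_nhds.add hε)
    have := ge_of_tendsto lim (b := gdist q l (δ s) (δ t)) (Filter.Eventually.of_forall fun n => by
      have a1 := tri _ (hδ s hs).1 _ (h1 n s hs) _ (hδ t ht).1
      have a2 := tri _ (h1 n s hs) _ (h1 n t ht) _ (hδ t ht).1
      have a3 := g6 _ (h1 n s hs) _ (hδ s hs).1
      have a4 := g6 _ (h1 n t ht) _ (hδ t ht).1
      have a5 := h3 n s hs t ht
      rw [sym] at a3
      linarith)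
    simpa using this
  have eqle : ∀ s ∈ Set.Icc (0:ℝ) 1, ∀ t ∈ Set.Icc (0:ℝ) 1, s ≤ t →
      gdist q l (δ s) (δ t) = |s - t| * gdist q l x y := by
    intro s hs t ht hst
    refine le_antisymm (up s hs t ht) ?_
    have a1 := up 0 zero s hs
    have a2 := up t ht 1 one
    rw [d0] at a1
    rw [d1] at a2
    have a3 := tri x hx _ (hδ s hs).1 y hy
    have a4 := tri _ (hδ s hs).1 _ (hδ t ht).1 y hy
    rw [abs_of_nonpos (by linarith [hs.1])] at a1
    rw [abs_of_nonpos (by linarith [ht.2])] at a2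
    rw [abs_of_nonpos (by linarith)]
    linarith
  refine ⟨δ, ?_, fun t ht => (hδ t ht).1, d0, d1, ?_⟩
  · have : LipschitzOnWith (gdist q l x y).toNNReal δ (Set.Icc 0 1) := by
      refine LipschitzOnWith.of_dist_le_mul fun s hs t ht => ?_
      rw [Real.coe_toNNReal _ D0, Real.dist_eq, mul_comm]
      exact (g1 _ (hδ s hs).1 _ (hδ t ht).1).trans (up s hs t ht)
    exact this.continuousOn
  · intro s hs t ht
    have e : gdist q l (δ s) (δ t) = |s - t| * gdist q l x y := by
      rcases le_total s t with h | h
      · exact eqle s hs t ht h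
      · rw [sym, abs_sub_comm]
        exact eqle t ht s hs h
    rw [← ENNReal.ofReal_toReal (fin _ (hδ s hs).1 _ (hδ t ht).1),
      ← ENNReal.ofReal_toReal (fin x hx y hy), ← ENNReal.ofReal_mul (abs_nonneg _)]
    exact congrArg ENNReal.ofReal e


/-- The cell maps, indexed symmetrically by barycentric triples. -/
def gm (q : Fin 3 → E2) (l : ℕ) (i : Fin 3 → ℕ) (x : E2) : E2 :=
  (l : ℝ)⁻¹ • (∑ k, (i k : ℝ) • q k + x)

/-- Barycentric triples of the boundary cells. -/
def SS (l : ℕ) : Set (Fin 3 → ℕ) := {i | ∑ k, i k + 1 = l ∧ ∃ k, i k = 0}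

theorem sum3 {M : Type*} [AddCommMonoid M] {a b c : Fin 3} (hab : a ≠ b) (hac : a ≠ c)
    (hbc : b ≠ c) (f : Fin 3 → M) : ∑ k, f k = f a + f b + f c := by
  have : (Finset.univ : Finset (Fin 3)) = {a, b, c} := by
    revert a b c; decide
  rw [this, Finset.sum_insert (by simp [hab, hac]), Finset.sum_insert (by simp [hbc]),
    Finset.sum_singleton, add_assoc]

theorem fmap_eq_gm (q : Fin 3 → E2) {l : ℕ} {i : Fin 3 → ℕ} (hi : i ∈ SS l) (x : E2) :
    fmap q l (i 1, i 2) x = gm q l i x := by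
  obtain ⟨h1, -⟩ := hi
  rw [Fin.sum_univ_three] at h1
  unfold fmap gm
  have hl : (l : ℝ) ≠ 0 := by
    have : l ≠ 0 := by omega
    exact_mod_cast this
  have h0 : (i 0 : ℝ) = l - 1 - i 1 - i 2 := by
    rw [← h1]; push_cast; ring
  rw [Fin.sum_univ_three, h0]
  match_scalars <;> field_simp <;> ring

theorem mem_Sset_of_SS {l : ℕ} {i : Fin 3 → ℕ} (hi : i ∈ SS l) : (i 1, i 2) ∈ Sset l := by
  obtain ⟨h1, k, hk⟩ := hi
  rw [Fin.sum_univ_three] at h1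
  refine ⟨by dsimp only; omega, ?_⟩
  dsimp only
  have : l - 1 - i 1 - i 2 = i 0 := by omega
  rw [this]
  fin_cases k <;> simp_all

theorem exists_SS {l : ℕ} (hl : 1 ≤ l) {p : ℕ × ℕ} (hp : p ∈ Sset l) :
    ∃ i ∈ SS l, p = (i 1, i 2) := by
  obtain ⟨h1, h2⟩ := hp
  refine ⟨![l - 1 - p.1 - p.2, p.1, p.2], ⟨?_, ?_⟩, by simp⟩
  · rw [Fin.sum_univ_three]
    simp
    omega
  · rcases Nat.mul_eq_zero.1 h2 with h | h
    · rcases Nat.mul_eq_zero.1 h with h | h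
      · exact ⟨1, by simpa using h⟩
      · exact ⟨2, by simpa using h⟩
    · exact ⟨0, by simpa using h⟩

/-- The level-`n` approximation of the gasket. -/
def GG (q : Fin 3 → E2) : ℕ → (ℕ → ℕ) → Set E2
  | 0, _ => Tri q
  | n + 1, l => ⋃ i ∈ SS (l 0), gm q (l 0) i '' GG q n (fun k => l (k + 1))

theorem wordMap_succ (q : Fin 3 → E2) (l : ℕ → ℕ) (w : ℕ → ℕ × ℕ) (n : ℕ) :
    wordMap q l w (n + 1) =
      fmap q (l 0) (w 0) ∘ wordMap q (fun k => l (k + 1)) (fun k => w (k + 1)) n := by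
  induction n with
  | zero => rfl
  | succ n ih =>
    rw [wordMap, ih]
    rfl

theorem GG_eq (q : Fin 3 → E2) (n : ℕ) : ∀ l : ℕ → ℕ, (∀ n, 1 ≤ l n) →
    (⋃ w ∈ Wn l n, wordMap q l w n '' Tri q) = GG q n l := by
  induction n with
  | zero =>
    intro l hl
    ext x
    simp only [GG, wordMap, Set.mem_iUnion, Set.image_id]
    constructor
    · rintro ⟨w, _, h⟩
      exact h
    · intro h
      exact ⟨fun _ => (0, 0), ⟨fun k hk => absurd hk (Nat.not_lt_zero k), fun _ _ => rfl⟩, h⟩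
  | succ n ih =>
    intro l hl
    have ih' := ih (fun k => l (k + 1)) (fun k => hl _)
    ext x
    simp only [GG, ← ih', Set.mem_iUnion]
    constructor
    · rintro ⟨w, hw, t, ht, rfl⟩
      obtain ⟨i, hi, hi'⟩ := exists_SS (hl 0) (hw.1 0 (Nat.succ_pos n))
      refine ⟨i, hi, wordMap q (fun k => l (k + 1)) (fun k => w (k + 1)) n t, ?_, ?_⟩
      · simp only [Set.mem_iUnion]
        exact ⟨fun k => w (k + 1), ⟨fun k hk => hw.1 (k + 1) (by omega),
          fun k hk => hw.2 (k + 1) (by omega)⟩, t, ht, rfl⟩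
      · rw [wordMap_succ, Function.comp, hi', fmap_eq_gm q hi]
    · rintro ⟨i, hi, y, hy, rfl⟩
      simp only [Set.mem_iUnion] at hy
      obtain ⟨w, hw, t, ht, rfl⟩ := hy
      refine ⟨fun k => Nat.casesOn k (i 1, i 2) w, ⟨?_, ?_⟩, t, ht, ?_⟩
      · intro k hk
        cases k with
        | zero => exact mem_Sset_of_SS hi
        | succ k => exact hw.1 k (by omega)
      · intro k hk
        cases k with
        | zero => omega
        | succ k => exact hw.2 k (by omega)
      · rw [wordMap_succ, Function.comp, ← fmap_eq_gm q hi]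
        rfl

theorem Gasket_eq (q : Fin 3 → E2) (l : ℕ → ℕ) (hl : ∀ n, 1 ≤ l n) :
    Gasket q l = ⋂ n, GG q n l := by
  unfold Gasket
  simp only [GG_eq q _ l hl]

theorem mem_Tri_iff (q : Fin 3 → E2) {a b c : Fin 3} (hab : a ≠ b) (hac : a ≠ c)
    (hbc : b ≠ c) (x : E2) : x ∈ Tri q ↔ ∃ s t u : ℝ, 0 ≤ s ∧ 0 ≤ t ∧ 0 ≤ u ∧ s + t + u = 1 ∧
      x = s • q a + t • q b + u • q c := by
  have hr : Set.range q = {q a, q b, q c} := by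
    ext y
    constructor
    · rintro ⟨k, rfl⟩
      have : k = a ∨ k = b ∨ k = c := by revert a b c k; decide
      rcases this with rfl | rfl | rfl <;> simp
    · rintro (rfl | rfl | rfl) <;> simp
  unfold Tri
  rw [hr]
  constructor
  · intro hx
    rw [convexHull_insert (by simp), convexHull_pair, mem_convexJoin] at hx
    obtain ⟨y, hy, z, hz, hx⟩ := hx
    rw [Set.mem_singleton_iff] at hy
    subst hy
    obtain ⟨p, r, hp, hr, hpr, rfl⟩ := hz
    obtain ⟨p', r', hp', hr', hpr', rfl⟩ := hx
    refine ⟨p', r' * p, r' * r, hp', by positivity, by positivity, ?_, ?_⟩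
    · rw [add_assoc, ← mul_add, hpr, mul_one, hpr']
    · rw [smul_add, smul_smul, smul_smul, add_assoc]
  · rintro ⟨s, t, u, hs, ht, hu, h1, rfl⟩
    have hc := convex_convexHull ℝ ({q a, q b, q c} : Set E2)
    have ma : q a ∈ convexHull ℝ ({q a, q b, q c} : Set E2) := subset_convexHull _ _ (by simp)
    have mb : q b ∈ convexHull ℝ ({q a, q b, q c} : Set E2) := subset_convexHull _ _ (by simp)
    have mc : q c ∈ convexHull ℝ ({q a, q b, q c} : Set E2) := subset_convexHull _ _ (by simp)
    have := hc.sum_mem (t := Finset.univ) (w := ![s, t, u]) (z := ![q a, q b, q c])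
      (by intro i _; fin_cases i <;> simpa) (by simp [Fin.sum_univ_three, h1])
      (by intro i _; fin_cases i <;> simpa)
    simpa [Fin.sum_univ_three] using this

theorem gm_Tri (q : Fin 3 → E2) {l : ℕ} {i : Fin 3 → ℕ} (hi : i ∈ SS l) {x : E2}
    (hx : x ∈ Tri q) : gm q l i x ∈ Tri q := by
  have h01 : (0 : Fin 3) ≠ 1 := by decide
  have h02 : (0 : Fin 3) ≠ 2 := by decide
  have h12 : (1 : Fin 3) ≠ 2 := by decide
  rw [mem_Tri_iff q h01 h02 h12] at hx ⊢
  obtain ⟨s, t, u, hs, ht, hu, h1, rfl⟩ := hx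
  obtain ⟨h2, -⟩ := hi
  rw [Fin.sum_univ_three] at h2
  have hl : (0:ℝ) < l := by
    have : 0 < l := by omega
    exact_mod_cast this
  have h2' : (i 0 : ℝ) + i 1 + i 2 + 1 = l := by exact_mod_cast h2
  refine ⟨(i 0 + s) / l, (i 1 + t) / l, (i 2 + u) / l, by positivity, by positivity,
    by positivity, ?_, ?_⟩
  · field_simp
    linarith
  · unfold gm
    rw [Fin.sum_univ_three]
    match_scalars <;> field_simp

theorem GG_succ_subset (q : Fin 3 → E2) (n : ℕ) : ∀ l : ℕ → ℕ, GG q (n + 1) l ⊆ GG q n l := by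
  induction n with
  | zero =>
    intro l x hx
    simp only [GG, Set.mem_iUnion] at hx
    obtain ⟨i, hi, y, hy, rfl⟩ := hx
    exact gm_Tri q hi hy
  | succ n ih =>
    intro l x hx
    rw [GG] at hx ⊢
    simp only [Set.mem_iUnion] at hx ⊢
    obtain ⟨i, hi, y, hy, rfl⟩ := hx
    exact ⟨i, hi, y, ih _ hy, rfl⟩

theorem GG_antitone (q : Fin 3 → E2) (l : ℕ → ℕ) : Antitone (fun n => GG q n l) :=
  antitone_nat_of_succ_le fun n => GG_succ_subset q n l

theorem SS_finite (l : ℕ) : (SS l).Finite := by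
  refine Set.Finite.subset (Set.Finite.pi' (t := fun _ : Fin 3 => Set.Iio l)
    (fun _ => Set.finite_Iio l)) ?_
  rintro i ⟨h, -⟩ k
  have : i k ≤ ∑ k, i k := Finset.single_le_sum (f := i) (fun _ _ => Nat.zero_le _)
    (Finset.mem_univ k)
  show i k < l
  omega

theorem gm_dist (q : Fin 3 → E2) (l : ℕ) (i : Fin 3 → ℕ) (x y : E2) :
    dist (gm q l i x) (gm q l i y) = (l : ℝ)⁻¹ * dist x y := by
  unfold gm
  rw [dist_smul₀, dist_add_left, Real.norm_of_nonneg (by positivity)]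

theorem gm_mem (q : Fin 3 → E2) {l : ℕ → ℕ} (hl : ∀ n, 1 ≤ l n) {i : Fin 3 → ℕ}
    (hi : i ∈ SS (l 0)) {x : E2} (hx : x ∈ Gasket q (fun k => l (k + 1))) :
    gm q (l 0) i x ∈ Gasket q l := by
  rw [Gasket_eq q _ (fun n => hl _)] at hx ⊢
  rw [Set.mem_iInter] at hx ⊢
  intro n
  refine GG_succ_subset q n l ?_
  rw [GG]
  simp only [Set.mem_iUnion]
  exact ⟨i, hi, x, hx n, rfl⟩

theorem exists_cell (q : Fin 3 → E2) {l : ℕ → ℕ} (hl : ∀ n, 1 ≤ l n) {x : E2}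
    (hx : x ∈ Gasket q l) : ∃ i ∈ SS (l 0), ∃ y ∈ Gasket q (fun k => l (k + 1)),
      x = gm q (l 0) i y := by
  rw [Gasket_eq q _ hl, Set.mem_iInter] at hx
  have hx' : ∀ n, ∃ i : SS (l 0), ∃ y ∈ GG q n (fun k => l (k + 1)), gm q (l 0) i y = x := by
    intro n
    have := hx (n + 1)
    rw [GG] at this
    simp only [Set.mem_iUnion] at this
    obtain ⟨i, hi, y, hy, h⟩ := this
    exact ⟨⟨i, hi⟩, y, hy, h⟩
  choose i y hy hxy using hx'
  have : Finite (SS (l 0)) := (SS_finite (l 0)).to_subtype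
  obtain ⟨j, hj⟩ := Finite.exists_infinite_fiber i
  have hinf : (i ⁻¹' {j}).Infinite := Set.infinite_coe_iff.1 hj
  have hl0 : (0:ℝ) < l 0 := by exact_mod_cast hl 0
  have uniq : ∀ n m, i n = j → i m = j → y n = y m := by
    intro n m hn hm
    have h1 := hxy n
    have h2 := hxy m
    rw [hn] at h1
    rw [hm, ← h1] at h2
    have := gm_dist q (l 0) j (y m) (y n)
    rw [h2, dist_self] at this
    have h3 : dist (y m) (y n) = 0 := by
      rcases mul_eq_zero.1 this.symm with h | h
      · exact absurd h (by positivity)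
      · exact h
    exact (dist_eq_zero.1 h3).symm
  obtain ⟨n0, hn0⟩ := hinf.nonempty
  refine ⟨j, j.2, y n0, ?_, ?_⟩
  · rw [Gasket_eq q _ (fun n => hl _), Set.mem_iInter]
    intro n
    obtain ⟨m, hm, hnm⟩ := hinf.exists_gt n
    rw [uniq n0 m hn0 hm]
    exact GG_antitone q _ hnm.le (hy m)
  · rw [← hxy n0, hn0]

theorem GG_compact (q : Fin 3 → E2) (n : ℕ) : ∀ l : ℕ → ℕ, IsCompact (GG q n l) := by
  induction n with
  | zero =>
    intro l
    exact Set.Finite.isCompact_convexHull ℝ (Set.finite_range q)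
  | succ n ih =>
    intro l
    rw [GG]
    refine (SS_finite (l 0)).isCompact_biUnion fun i _ => (ih _).image ?_
    unfold gm
    fun_prop

theorem Gasket_compact (q : Fin 3 → E2) (l : ℕ → ℕ) (hl : ∀ n, 1 ≤ l n) :
    IsCompact (Gasket q l) := by
  rw [Gasket_eq q l hl]
  exact (GG_compact q 0 l).of_isClosed_subset (isClosed_iInter fun n => (GG_compact q n l).isClosed)
    (Set.iInter_subset _ 0)

theorem Gasket_sub_Tri (q : Fin 3 → E2) (l : ℕ → ℕ) (hl : ∀ n, 1 ≤ l n) :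
    Gasket q l ⊆ Tri q := by
  rw [Gasket_eq q l hl]
  exact Set.iInter_subset _ 0

theorem edge_GG (q : Fin 3 → E2) {a b : Fin 3} (hab : a ≠ b) (n : ℕ) : ∀ l : ℕ → ℕ,
    (∀ n, 1 ≤ l n) → ∀ s ∈ Set.Icc (0:ℝ) 1, q a + s • (q b - q a) ∈ GG q n l := by
  obtain ⟨c, hac, hbc⟩ : ∃ c, a ≠ c ∧ b ≠ c := by revert a b; decide
  induction n with
  | zero =>
    rintro l hl s ⟨hs0, hs1⟩
    show _ ∈ Tri q
    rw [mem_Tri_iff q hab hac hbc]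
    refine ⟨1 - s, s, 0, by linarith, hs0, le_rfl, by ring, ?_⟩
    module
  | succ n ih =>
    rintro l hl s ⟨hs0, hs1⟩
    rw [GG]
    simp only [Set.mem_iUnion]
    have hl0 : (0:ℝ) < l 0 := by exact_mod_cast hl 0
    obtain ⟨m, hm, hm0, hm1⟩ : ∃ m : ℕ, m + 1 ≤ l 0 ∧ (m:ℝ) ≤ s * l 0 ∧ s * l 0 ≤ m + 1 := by
      by_cases h : s = 1
      · subst h
        refine ⟨l 0 - 1, by have := hl 0; omega, ?_, ?_⟩
        · rw [Nat.cast_sub (hl 0)]; push_cast; linarith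
        · rw [Nat.cast_sub (hl 0)]; push_cast; linarith
      · have hs : s < 1 := lt_of_le_of_ne hs1 h
        refine ⟨⌊s * l 0⌋₊, ?_, Nat.floor_le (by positivity), (Nat.lt_floor_add_one _).le⟩
        have : ⌊s * l 0⌋₊ < l 0 := by
          rw [Nat.floor_lt (by positivity)]
          nlinarith
        omega
    refine ⟨fun k => if k = a then l 0 - 1 - m else if k = b then m else 0, ⟨?_, c, ?_⟩,
      q a + (s * l 0 - m) • (q b - q a), ih _ (fun n => hl _) _ ⟨by linarith, by linarith⟩, ?_⟩
    · rw [sum3 hab hac hbc]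
      simp [hab.symm, hac.symm, hbc.symm]
      omega
    · simp [hac.symm, hbc.symm]
    · unfold gm
      rw [sum3 hab hac hbc]
      have : ((l 0 - 1 - m : ℕ) : ℝ) = l 0 - 1 - m := by
        rw [Nat.sub_sub, Nat.cast_sub (by omega)]; push_cast; ring
      simp only [hab.symm, hac.symm, hbc.symm, if_true, if_false, this]
      match_scalars <;> field_simp <;> ring

theorem edge_mem (q : Fin 3 → E2) {a b : Fin 3} (hab : a ≠ b) (l : ℕ → ℕ)
    (hl : ∀ n, 1 ≤ l n) {s : ℝ} (hs : s ∈ Set.Icc (0:ℝ) 1) :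
    q a + s • (q b - q a) ∈ Gasket q l := by
  rw [Gasket_eq q l hl, Set.mem_iInter]
  exact fun n => edge_GG q hab n l hl s hs

theorem q_mem (q : Fin 3 → E2) (a : Fin 3) (l : ℕ → ℕ) (hl : ∀ n, 1 ≤ l n) :
    q a ∈ Gasket q l := by
  obtain ⟨b, hab⟩ : ∃ b, a ≠ b := by revert a; decide
  simpa using edge_mem q hab l hl (s := 0) (by simp)


theorem inner_half (q : Fin 3 → E2) (hq : ∀ j k : Fin 3, j ≠ k → dist (q j) (q k) = 1)
    {a b c : Fin 3} (hab : a ≠ b) (hac : a ≠ c) (hbc : b ≠ c) :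
    inner ℝ (q b - q a) (q c - q a) = 1 / 2 := by
  have h1 : ‖q b - q a‖ = 1 := by rw [← dist_eq_norm]; exact hq _ _ hab.symm
  have h2 : ‖q c - q a‖ = 1 := by rw [← dist_eq_norm]; exact hq _ _ hac.symm
  have h3 : ‖(q b - q a) - (q c - q a)‖ = 1 := by
    rw [sub_sub_sub_cancel_right, ← dist_eq_norm]; exact hq _ _ hbc
  have := norm_sub_sq_real (q b - q a) (q c - q a)
  rw [h1, h2, h3] at this
  linarith

theorem nsq (q : Fin 3 → E2) (hq : ∀ j k : Fin 3, j ≠ k → dist (q j) (q k) = 1)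
    {a b c : Fin 3} (hab : a ≠ b) (hac : a ≠ c) (hbc : b ≠ c) (α β : ℝ) :
    ‖α • (q b - q a) + β • (q c - q a)‖ ^ 2 = α ^ 2 + α * β + β ^ 2 := by
  have h1 : ‖q b - q a‖ = 1 := by rw [← dist_eq_norm]; exact hq _ _ hab.symm
  have h2 : ‖q c - q a‖ = 1 := by rw [← dist_eq_norm]; exact hq _ _ hac.symm
  rw [norm_add_sq_real, norm_smul, norm_smul, h1, h2, inner_smul_left, inner_smul_right,
    inner_half q hq hab hac hbc]
  simp only [mul_one, Real.norm_eq_abs, sq_abs, conj_trivial]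
  ring

/-- Two points in two cells meeting at a vertex at an angle of at least `π/3`. -/
theorem adj_ineq (q : Fin 3 → E2) (hq : ∀ j k : Fin 3, j ≠ k → dist (q j) (q k) = 1)
    {a b c : Fin 3} (hab : a ≠ b) (hac : a ≠ c) (hbc : b ≠ c) {x y : E2}
    (hx : x ∈ Tri q) (hy : y ∈ Tri q) :
    ‖x - q b‖ + ‖y - q a‖ ≤ 2 * ‖(x - q b) - (y - q a)‖ := by
  obtain ⟨s, t, u, hs, ht, hu, h1, rfl⟩ := (mem_Tri_iff q hab hac hbc x).1 hx
  obtain ⟨s', t', u', hs', ht', hu', h1', rfl⟩ := (mem_Tri_iff q hab hac hbc y).1 hy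
  obtain rfl : t = 1 - s - u := by linarith
  obtain rfl : s' = 1 - t' - u' := by linarith
  have eX : s • q a + (1 - s - u) • q b + u • q c - q b
      = (-(s + u)) • (q b - q a) + u • (q c - q a) := by module
  have eY : (1 - t' - u') • q a + t' • q b + u' • q c - q a
      = t' • (q b - q a) + u' • (q c - q a) := by module
  have eZ : (-(s + u)) • (q b - q a) + u • (q c - q a) - (t' • (q b - q a) + u' • (q c - q a))
      = (-(s + u) - t') • (q b - q a) + (u - u') • (q c - q a) := by module
  rw [eX, eY, eZ]
  have nX := nsq q hq hab hac hbc (-(s + u)) u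
  have nY := nsq q hq hab hac hbc t' u'
  have nZ := nsq q hq hab hac hbc (-(s + u) - t') (u - u')
  set X := ‖(-(s + u)) • (q b - q a) + u • (q c - q a)‖
  set Y := ‖t' • (q b - q a) + u' • (q c - q a)‖
  set Z := ‖(-(s + u) - t') • (q b - q a) + (u - u') • (q c - q a)‖
  have X0 : 0 ≤ X := norm_nonneg _
  have Y0 : 0 ≤ Y := norm_nonneg _
  have Z0 : 0 ≤ Z := norm_nonneg _
  have hX : u ≤ X := abs_le_of_sq_le_sq' (by nlinarith [mul_nonneg hs hu]) X0 |>.2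
  have hY : u' ≤ Y := abs_le_of_sq_le_sq' (by nlinarith [mul_nonneg ht' hu']) Y0 |>.2
  have hXY : u * u' ≤ X * Y := mul_le_mul hX hY hu' X0
  refine abs_le_of_sq_le_sq' ?_ (by positivity) |>.2
  have : X ^ 2 + Y ^ 2 - u * u' ≤ Z ^ 2 := by
    rw [nX, nY, nZ]
    nlinarith [mul_nonneg hs ht', mul_nonneg hs hu', mul_nonneg hu ht']
  nlinarith [sq_nonneg (X - Y)]

theorem dist_le_one (q : Fin 3 → E2) (hq : ∀ j k : Fin 3, j ≠ k → dist (q j) (q k) = 1)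
    {x y : E2} (hx : x ∈ Tri q) (hy : y ∈ Tri q) : dist x y ≤ 1 := by
  obtain ⟨x', hx', y', hy', h⟩ := convexHull_exists_dist_ge2 hx hy
  refine h.trans ?_
  obtain ⟨j, rfl⟩ := hx'
  obtain ⟨k, rfl⟩ := hy'
  by_cases hjk : j = k
  · subst hjk; simp
  · exact (hq j k hjk).le

section

variable {q : Fin 3 → E2}

theorem JJ_edge (hq : ∀ j k : Fin 3, j ≠ k → dist (q j) (q k) = 1) {a b : Fin 3} (hab : a ≠ b)
    {l : ℕ → ℕ} (hl : ∀ n, 5 ≤ l n) {s t : ℝ} (hs : s ∈ Set.Icc (0:ℝ) 1)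
    (ht : t ∈ Set.Icc (0:ℝ) 1) :
    JJ (Gasket q l) (q a + s • (q b - q a)) (q a + t • (q b - q a)) |s - t| := by
  have h := JJ.seg (K := Gasket q l) (x := q a + s • (q b - q a)) (y := q a + t • (q b - q a)) ?_
  · convert h using 1
    rw [dist_add_left, dist_eq_norm, ← sub_smul, norm_smul, ← dist_eq_norm (q b), hq _ _ hab.symm,
      mul_one, Real.norm_eq_abs]
  · rintro r ⟨hr0, hr1⟩
    have : q a + s • (q b - q a) + r • (q a + t • (q b - q a) - (q a + s • (q b - q a)))
        = q a + ((1 - r) * s + r * t) • (q b - q a) := by module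
    rw [this]
    refine edge_mem q hab l (fun n => le_trans (by norm_num) (hl n)) ⟨?_, ?_⟩
    · have := hs.1; have := ht.1
      have : 0 ≤ 1 - r := by linarith
      positivity
    · have := hs.2; have := ht.2
      nlinarith

theorem JJ_gm {l : ℕ → ℕ} (hl : ∀ n, 5 ≤ l n) {i : Fin 3 → ℕ} (hi : i ∈ SS (l 0)) {x y : E2}
    {T : ℝ} (h : JJ (Gasket q (fun k => l (k + 1))) x y T) :
    JJ (Gasket q l) (gm q (l 0) i x) (gm q (l 0) i y) ((l 0 : ℝ)⁻¹ * T) := by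
  have h1 : ∀ n, 1 ≤ l n := fun n => le_trans (by norm_num) (hl n)
  have hl0 : (0:ℝ) < l 0 := by exact_mod_cast h1 0
  exact h.map (by positivity) _ (fun x hx => gm_mem q h1 hi hx) (gm_dist q _ i)

/-- A boundary point is joined to every corner by a path of length at most `3/2`. -/
theorem JJ_bdry (hq : ∀ j k : Fin 3, j ≠ k → dist (q j) (q k) = 1) {a b : Fin 3} (hab : a ≠ b)
    {l : ℕ → ℕ} (hl : ∀ n, 5 ≤ l n) {s : ℝ} (hs : s ∈ Set.Icc (0:ℝ) 1) (j : Fin 3) :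
    JJ (Gasket q l) (q a + s • (q b - q a)) (q j) (3 / 2) := by
  have z0 : (0:ℝ) ∈ Set.Icc (0:ℝ) 1 := by simp
  have z1 : (1:ℝ) ∈ Set.Icc (0:ℝ) 1 := by simp
  have ha := JJ_edge hq hab hl hs z0
  have hb := JJ_edge hq hab hl hs z1
  rw [zero_smul, add_zero, sub_zero, abs_of_nonneg hs.1] at ha
  rw [one_smul, add_sub_cancel, abs_of_nonpos (by linarith [hs.2])] at hb
  by_cases h1 : a = j
  · subst h1
    exact ha.mono (by linarith [hs.2])
  by_cases h2 : b = j
  · subst h2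
    exact hb.mono (by linarith [hs.1])
  have ea := JJ_edge hq h1 hl z0 z1
  have eb := JJ_edge hq h2 hl z0 z1
  simp only [zero_smul, add_zero, one_smul, add_sub_cancel, zero_sub, abs_neg, abs_one] at ea eb
  rcases le_total s (1 / 2) with h | h
  · exact (ha.trans ea).mono (by linarith)
  · exact (hb.trans eb).mono (by linarith)

theorem gm_vertex {l : ℕ} (hl : 1 ≤ l) {i : Fin 3 → ℕ} (hi : i ∈ SS l) {a b c : Fin 3}
    (hab : a ≠ b) (hac : a ≠ c) (hbc : b ≠ c) (hc : i c = 0) :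
    gm q l i (q a) = q a + ((i b : ℝ) / l) • (q b - q a) := by
  obtain ⟨h, -⟩ := hi
  rw [sum3 hab hac hbc, hc] at h
  have hl0 : (l:ℝ) ≠ 0 := by
    have : l ≠ 0 := by omega
    exact_mod_cast this
  have : (i a : ℝ) = l - 1 - i b := by rw [← h]; push_cast; ring
  unfold gm
  rw [sum3 hab hac hbc, hc, this]
  match_scalars <;> field_simp <;> ring

theorem others (c : Fin 3) : ∃ a b : Fin 3, a ≠ b ∧ a ≠ c ∧ b ≠ c := by
  revert c; decide

theorem SS_frac {l : ℕ} {i : Fin 3 → ℕ} (hi : i ∈ SS l) (b : Fin 3) :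
    (i b : ℝ) / l ∈ Set.Icc (0:ℝ) 1 := by
  obtain ⟨h, -⟩ := hi
  have : i b ≤ ∑ k, i k := Finset.single_le_sum (f := i) (fun _ _ => Nat.zero_le _)
    (Finset.mem_univ b)
  refine ⟨by positivity, ?_⟩
  have hl0 : (0:ℝ) < l := by
    have : 0 < l := by omega
    exact_mod_cast this
  rw [div_le_one hl0]
  have : i b ≤ l := by omega
  exact_mod_cast this

theorem JJ_two_approx (hq : ∀ j k : Fin 3, j ≠ k → dist (q j) (q k) = 1) (n : ℕ) :
    ∀ l : ℕ → ℕ, (∀ n, 5 ≤ l n) → ∀ x ∈ Gasket q l, ∀ j, ∃ u, dist u x ≤ (1 / 5 : ℝ) ^ n ∧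
      JJ (Gasket q l) u (q j) 2 := by
  induction n with
  | zero =>
    intro l hl x hx j
    have h1 : ∀ n, 1 ≤ l n := fun n => le_trans (by norm_num) (hl n)
    refine ⟨q j, ?_, JJ.refl (q_mem q j l h1) (by norm_num)⟩
    rw [pow_zero]
    exact dist_le_one q hq (Gasket_sub_Tri q l h1 (q_mem q j l h1)) (Gasket_sub_Tri q l h1 hx)
  | succ n ih =>
    intro l hl x hx j
    have h1 : ∀ n, 1 ≤ l n := fun n => le_trans (by norm_num) (hl n)
    obtain ⟨i, hi, y, hy, rfl⟩ := exists_cell q h1 hx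
    obtain ⟨c, hc⟩ := hi.2
    obtain ⟨a, b, hab, hac, hbc⟩ := others c
    obtain ⟨u, hu, hJ⟩ := ih _ (fun n => hl _) y hy a
    have h5 : (5:ℝ) ≤ l 0 := by exact_mod_cast hl 0
    have hinv : (l 0 : ℝ)⁻¹ ≤ 1 / 5 := by
      rw [one_div]; exact inv_anti₀ (by norm_num) h5
    refine ⟨gm q (l 0) i u, ?_, ?_⟩
    · rw [gm_dist, pow_succ']
      exact mul_le_mul hinv hu dist_nonneg (by norm_num)
    · have e1 := JJ_gm hl hi hJ
      have e2 := JJ_bdry hq hab hl (SS_frac hi b) j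
      rw [← gm_vertex (h1 0) hi hab hac hbc hc] at e2
      exact (e1.trans e2).mono (by linarith)

theorem JJ_two (hq : ∀ j k : Fin 3, j ≠ k → dist (q j) (q k) = 1)
    {l : ℕ → ℕ} (hl : ∀ n, 5 ≤ l n) {x : E2} (hx : x ∈ Gasket q l) (j : Fin 3) :
    JJ (Gasket q l) x (q j) 2 := by
  have h1 : ∀ n, 1 ≤ l n := fun n => le_trans (by norm_num) (hl n)
  choose u hu hJ using fun n => JJ_two_approx hq n l hl x hx j
  refine JJ.limit (Gasket_compact q l h1) u ?_ hJ
  rw [tendsto_iff_dist_tendsto_zero]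
  exact squeeze_zero (fun _ => dist_nonneg) hu
    (tendsto_pow_atTop_nhds_zero_of_lt_one (by norm_num) (by norm_num))

/-- Induction along the cells containing the corner `q a`. -/
theorem corner_ind (hq : ∀ j k : Fin 3, j ≠ k → dist (q j) (q k) = 1) (a : Fin 3)
    (P : (ℕ → ℕ) → E2 → Prop)
    (hP0 : ∀ l, (∀ n, 5 ≤ l n) → P l (q a))
    (hP1 : ∀ l, (∀ n, 5 ≤ l n) → ∀ i ∈ SS (l 0), i a + 1 = l 0 →
      ∀ x ∈ Gasket q (fun k => l (k + 1)), P (fun k => l (k + 1)) x → P l (gm q (l 0) i x))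
    (hP2 : ∀ l, (∀ n, 5 ≤ l n) → ∀ i ∈ SS (l 0), i a + 1 ≠ l 0 →
      ∀ x ∈ Gasket q (fun k => l (k + 1)), P l (gm q (l 0) i x)) :
    ∀ l, (∀ n, 5 ≤ l n) → ∀ x ∈ Gasket q l, P l x := by
  have main : ∀ n : ℕ, ∀ l : ℕ → ℕ, (∀ n, 5 ≤ l n) → ∀ x ∈ Gasket q l,
      (1 / 5 : ℝ) ^ n < dist x (q a) → P l x := by
    intro n
    induction n with
    | zero =>
      intro l hl x hx h
      have h1 : ∀ n, 1 ≤ l n := fun n => le_trans (by norm_num) (hl n)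
      have := dist_le_one q hq (Gasket_sub_Tri q l h1 hx)
        (Gasket_sub_Tri q l h1 (q_mem q a l h1))
      rw [pow_zero] at h
      linarith
    | succ n ih =>
      intro l hl x hx h
      have h1 : ∀ n, 1 ≤ l n := fun n => le_trans (by norm_num) (hl n)
      obtain ⟨i, hi, y, hy, rfl⟩ := exists_cell q h1 hx
      by_cases hia : i a + 1 = l 0
      · refine hP1 l hl i hi hia y hy (ih _ (fun n => hl _) y hy ?_)
        have hqa : q a = gm q (l 0) i (q a) := by
          obtain ⟨b, c, hbc, hba, hca⟩ := others a
          have hs := hi.1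
          rw [sum3 hba.symm hca.symm hbc] at hs
          have hc : i c = 0 := by omega
          have hb : i b = 0 := by omega
          rw [gm_vertex (h1 0) hi hba.symm hca.symm hbc hc, hb]
          simp
        rw [hqa, gm_dist, pow_succ'] at h
        have h5 : (5:ℝ) ≤ l 0 := by exact_mod_cast hl 0
        have hinv : (l 0 : ℝ)⁻¹ ≤ 1 / 5 := by
          rw [one_div]; exact inv_anti₀ (by norm_num) h5
        have := mul_le_mul_of_nonneg_right hinv (dist_nonneg (x := y) (y := q a))
        linarith
      · exact hP2 l hl i hi hia y hy
  intro l hl x hx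
  by_cases h : x = q a
  · subst h; exact hP0 l hl
  · obtain ⟨n, hn⟩ := exists_pow_lt_of_lt_one (dist_pos.2 h) (show (1 / 5 : ℝ) < 1 by norm_num)
    exact main n l hl x hx hn

end


section

variable {q : Fin 3 → E2}

theorem tri_co {a b c : Fin 3} (hab : a ≠ b) (hac : a ≠ c) (hbc : b ≠ c) {x : E2}
    (hx : x ∈ Tri q) : ∃ β γ : ℝ, 0 ≤ β ∧ 0 ≤ γ ∧ β + γ ≤ 1 ∧
      x = q a + β • (q b - q a) + γ • (q c - q a) := by
  obtain ⟨s, t, u, hs, ht, hu, h1, rfl⟩ := (mem_Tri_iff q hab hac hbc x).1 hx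
  obtain rfl : s = 1 - t - u := by linarith
  exact ⟨t, u, ht, hu, by linarith, by module⟩

theorem gm_co {l : ℕ} {i : Fin 3 → ℕ} (hi : i ∈ SS l) {a b c : Fin 3}
    (hab : a ≠ b) (hac : a ≠ c) (hbc : b ≠ c) (β γ : ℝ) :
    gm q l i (q a + β • (q b - q a) + γ • (q c - q a)) =
      q a + ((i b + β) / l) • (q b - q a) + ((i c + γ) / l) • (q c - q a) := by
  obtain ⟨h, -⟩ := hi
  rw [sum3 hab hac hbc] at h
  have hl0 : (l:ℝ) ≠ 0 := by
    have : l ≠ 0 := by omega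
    exact_mod_cast this
  have : (i a : ℝ) = l - 1 - i b - i c := by rw [← h]; push_cast; ring
  unfold gm
  rw [sum3 hab hac hbc, this]
  match_scalars <;> field_simp <;> ring

theorem dist_co (hq : ∀ j k : Fin 3, j ≠ k → dist (q j) (q k) = 1) {a b c : Fin 3}
    (hab : a ≠ b) (hac : a ≠ c) (hbc : b ≠ c) (β γ β' γ' : ℝ) :
    dist (q a + β • (q b - q a) + γ • (q c - q a)) (q a + β' • (q b - q a) + γ' • (q c - q a)) ^ 2
      = (β - β') ^ 2 + (β - β') * (γ - γ') + (γ - γ') ^ 2 := by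
  rw [← nsq q hq hab hac hbc, dist_eq_norm]
  congr 2
  module

theorem JJ_side (hq : ∀ j k : Fin 3, j ≠ k → dist (q j) (q k) = 1) {l : ℕ → ℕ}
    (hl : ∀ n, 5 ≤ l n) {i : Fin 3 → ℕ} (hi : i ∈ SS (l 0)) {a b c : Fin 3}
    (hab : a ≠ b) (hac : a ≠ c) (hbc : b ≠ c) (hc : i c = 0) {x : E2} {T : ℝ}
    (h : JJ (Gasket q (fun k => l (k + 1))) x (q a) T) :
    JJ (Gasket q l) (gm q (l 0) i x) (q a) ((T + i b) / l 0) := by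
  have h1 : ∀ n, 1 ≤ l n := fun n => le_trans (by norm_num) (hl n)
  have e1 := JJ_gm hl hi h
  have e2 := JJ_edge hq hab hl (SS_frac hi b) (t := 0) (by simp)
  rw [← gm_vertex (h1 0) hi hab hac hbc hc, zero_smul, add_zero, sub_zero,
    abs_of_nonneg (SS_frac hi b).1] at e2
  refine (e1.trans e2).mono (le_of_eq ?_)
  rw [add_div, inv_mul_eq_div]

theorem JJ_crude (hq : ∀ j k : Fin 3, j ≠ k → dist (q j) (q k) = 1)
    {a b c : Fin 3} (hab : a ≠ b) (hac : a ≠ c) (hbc : b ≠ c) :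
    ∀ l, (∀ n, 5 ≤ l n) → ∀ x ∈ Gasket q l, ∃ β γ : ℝ, 0 ≤ β ∧ 0 ≤ γ ∧ β + γ ≤ 1 ∧
      x = q a + β • (q b - q a) + γ • (q c - q a) ∧
      JJ (Gasket q l) x (q a) (3 * (β + γ)) := by
  refine corner_ind hq a _ ?_ ?_ ?_
  · intro l hl
    have h1 : ∀ n, 1 ≤ l n := fun n => le_trans (by norm_num) (hl n)
    exact ⟨0, 0, le_rfl, le_rfl, by norm_num, by simp, JJ.refl (q_mem q a l h1) (by simp)⟩
  · rintro l hl i hi hia x hx ⟨β, γ, hβ, hγ, hs, hxe, hJ⟩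
    have hs' := hi.1
    rw [sum3 hab hac hbc] at hs'
    have hc : i c = 0 := by omega
    have hb : i b = 0 := by omega
    have h5 : (5:ℝ) ≤ l 0 := by exact_mod_cast hl 0
    have e := gm_co (q := q) hi hab hac hbc β γ
    rw [← hxe, hb, hc] at e
    refine ⟨_, _, by positivity, by positivity, ?_, e, ?_⟩
    · rw [← add_div, div_le_one (by linarith)]
      push_cast
      linarith
    · have := JJ_side hq hl hi hab hac hbc hc hJ
      refine this.mono (le_of_eq ?_)
      rw [hb]
      push_cast
      ring
  · intro l hl i hi hia x hx
    have h1 : ∀ n, 1 ≤ l n := fun n => le_trans (by norm_num) (hl n)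
    have h5 : (5:ℝ) ≤ l 0 := by exact_mod_cast hl 0
    have hxT := Gasket_sub_Tri q _ (fun n => h1 (n + 1)) hx
    have hs' := hi.1
    rw [sum3 hab hac hbc] at hs'
    have hsr : (i a : ℝ) + i b + i c + 1 = l 0 := by exact_mod_cast hs'
    obtain ⟨β, γ, hβ, hγ, hs, rfl⟩ := tri_co hab hac hbc hxT
    refine ⟨_, _, by positivity, by positivity, ?_, gm_co hi hab hac hbc β γ, ?_⟩
    · rw [← add_div, div_le_one (by linarith)]
      have : (0:ℝ) ≤ i a := by positivity
      linarith
    obtain ⟨k, hk⟩ := hi.2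
    have hk3 : k = a ∨ k = b ∨ k = c := by
      clear hk hs' hsr hs hxT hx hia
      revert a b c k; decide
    rw [← add_div]
    rcases hk3 with rfl | rfl | rfl
    · refine (JJ_two hq hl (gm_mem q h1 hi hx) k).mono ?_
      rw [← mul_div_assoc, le_div_iff₀ (by linarith)]
      rw [hk] at hsr
      push_cast at hsr
      linarith
    · have hp : (1:ℝ) ≤ i c := by
        have : 1 ≤ i c := by omega
        exact_mod_cast this
      refine (JJ_side hq hl hi hac hab hbc.symm hk (JJ_two hq (fun n => hl _) hx a)).mono ?_
      rw [← mul_div_assoc, hk]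
      push_cast
      gcongr
      linarith
    · have hp : (1:ℝ) ≤ i b := by
        have : 1 ≤ i b := by omega
        exact_mod_cast this
      refine (JJ_side hq hl hi hab hac hbc hk (JJ_two hq (fun n => hl _) hx a)).mono ?_
      rw [← mul_div_assoc, hk]
      push_cast
      gcongr
      linarith

theorem JJ_three (hq : ∀ j k : Fin 3, j ≠ k → dist (q j) (q k) = 1) (a : Fin 3) :
    ∀ l, (∀ n, 5 ≤ l n) → ∀ x ∈ Gasket q l, JJ (Gasket q l) x (q a) (3 * dist x (q a)) := by
  obtain ⟨b, c, hbc, hba, hca⟩ := others a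
  have hab := hba.symm
  have hac := hca.symm
  have qa0 : ∀ b c : Fin 3, q a = q a + (0:ℝ) • (q b - q a) + (0:ℝ) • (q c - q a) := by simp
  -- the case of a cell on a side containing `q a`
  have side : ∀ b c : Fin 3, a ≠ b → a ≠ c → b ≠ c → ∀ l, (∀ n, 5 ≤ l n) → ∀ i ∈ SS (l 0),
      1 ≤ i b → i c = 0 → ∀ x ∈ Gasket q (fun k => l (k + 1)),
      JJ (Gasket q l) (gm q (l 0) i x) (q a) (3 * dist (gm q (l 0) i x) (q a)) := by
    intro b c hab hac hbc l hl i hi hib hic x hx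
    obtain ⟨β, γ, hβ, hγ, hs, hxe, hJ⟩ := JJ_crude hq hab hac hbc _ (fun n => hl _) x hx
    refine (JJ_side hq hl hi hab hac hbc hic hJ).mono ?_
    have h5 : (5:ℝ) ≤ l 0 := by exact_mod_cast hl 0
    have hp : (1:ℝ) ≤ i b := by exact_mod_cast hib
    have hd := dist_co hq hab hac hbc ((i b + β) / l 0) ((i c + γ) / l 0) 0 0
    rw [← gm_co hi hab hac hbc, ← hxe, ← qa0, hic] at hd
    set d := dist (gm q (l 0) i x) (q a)
    have d0 : 0 ≤ d := dist_nonneg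
    rw [div_le_iff₀ (by linarith)]
    refine abs_le_of_sq_le_sq' ?_ (by positivity) |>.2
    have hd' : (d * l 0) ^ 2 = (i b + β) ^ 2 + (i b + β) * γ + γ ^ 2 := by
      rw [mul_pow, hd]
      have : (l 0 : ℝ) ≠ 0 := by linarith
      field_simp
      push_cast
      ring
    have : (3 * d * l 0) ^ 2 = 9 * (d * l 0) ^ 2 := by ring
    rw [this, hd']
    have hpp : β + γ ≤ i b := by linarith
    nlinarith [sq_nonneg (β - γ), mul_nonneg hβ hγ, mul_nonneg (by linarith : (0:ℝ) ≤ i b) hβ,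
      mul_nonneg (by linarith : (0:ℝ) ≤ i b) hγ, mul_self_le_mul_self (by linarith) hpp]
  refine corner_ind hq a _ ?_ ?_ ?_
  · intro l hl
    have h1 : ∀ n, 1 ≤ l n := fun n => le_trans (by norm_num) (hl n)
    exact JJ.refl (q_mem q a l h1) (by positivity)
  · intro l hl i hi hia x hx hJ
    have hs' := hi.1
    rw [sum3 hab hac hbc] at hs'
    have hc : i c = 0 := by omega
    have hb : i b = 0 := by omega
    have h1 : ∀ n, 1 ≤ l n := fun n => le_trans (by norm_num) (hl n)
    have hqa : gm q (l 0) i (q a) = q a := by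
      rw [gm_vertex (h1 0) hi hab hac hbc hc, hb]
      simp
    have := JJ_gm hl hi hJ
    rw [hqa] at this
    refine this.mono (le_of_eq ?_)
    conv_rhs => rw [← hqa, gm_dist]
    ring
  · intro l hl i hi hia x hx
    have h1 : ∀ n, 1 ≤ l n := fun n => le_trans (by norm_num) (hl n)
    have hs' := hi.1
    rw [sum3 hab hac hbc] at hs'
    obtain ⟨k, hk⟩ := hi.2
    have hk3 : k = a ∨ k = b ∨ k = c := by
      clear hk hs' hx hia side qa0
      revert a b c k; decide
    rcases hk3 with rfl | rfl | rfl
    · refine (JJ_two hq hl (gm_mem q h1 hi hx) k).mono ?_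
      have h5 : (5:ℝ) ≤ l 0 := by exact_mod_cast hl 0
      have hxT := Gasket_sub_Tri q _ (fun n => h1 (n + 1)) hx
      have hsr : (i k : ℝ) + i b + i c + 1 = l 0 := by exact_mod_cast hs'
      obtain ⟨β, γ, hβ, hγ, hs, rfl⟩ := tri_co hab hac hbc hxT
      have hd := dist_co hq hab hac hbc ((i b + β) / l 0) ((i c + γ) / l 0) 0 0
      rw [← gm_co hi hab hac hbc, ← qa0] at hd
      set d := dist (gm q (l 0) i (q k + β • (q b - q k) + γ • (q c - q k))) (q k)
      have d0 : 0 ≤ d := dist_nonneg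
      refine abs_le_of_sq_le_sq' ?_ (by positivity) |>.2
      rw [mul_pow, hd]
      have hge : 4 / 5 ≤ ((i b + β) / l 0) + ((i c + γ) / l 0) := by
        rw [← add_div, le_div_iff₀ (by linarith)]
        rw [hk] at hsr
        push_cast at hsr
        linarith
      set B := (i b + β) / (l 0 : ℝ)
      set C := (i c + γ) / (l 0 : ℝ)
      nlinarith [sq_nonneg (B - C)]
    · exact side c k hac hab hbc.symm l hl i hi (by omega) hk x hx
    · exact side b k hab hac hbc l hl i hi (by omega) hk x hx

/-- Two cells that meet at a vertex. -/
theorem JJ_adj (hq : ∀ j k : Fin 3, j ≠ k → dist (q j) (q k) = 1) {l : ℕ → ℕ}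
    (hl : ∀ n, 5 ≤ l n) {i j : Fin 3 → ℕ} (hi : i ∈ SS (l 0)) (hj : j ∈ SS (l 0))
    {a b : Fin 3} (hab : a ≠ b) (hv : gm q (l 0) i (q b) = gm q (l 0) j (q a)) {x y : E2}
    (hx : x ∈ Gasket q (fun k => l (k + 1))) (hy : y ∈ Gasket q (fun k => l (k + 1))) :
    JJ (Gasket q l) (gm q (l 0) i x) (gm q (l 0) j y)
      (6 * dist (gm q (l 0) i x) (gm q (l 0) j y)) := by
  obtain ⟨c, hac, hbc⟩ : ∃ c, a ≠ c ∧ b ≠ c := by clear hv; revert a b; decide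
  have h1 : ∀ n, 1 ≤ l n := fun n => le_trans (by norm_num) (hl n)
  have e1 := JJ_gm hl hi (JJ_three hq b _ (fun n => hl _) x hx)
  have e2 := JJ_gm hl hj (JJ_three hq a _ (fun n => hl _) y hy)
  rw [hv] at e1
  refine (e1.trans e2.symm).mono ?_
  have := adj_ineq q hq hab hac hbc (Gasket_sub_Tri q _ (fun n => h1 (n + 1)) hx)
    (Gasket_sub_Tri q _ (fun n => h1 (n + 1)) hy)
  have hd : dist (gm q (l 0) i x) (gm q (l 0) j y) =
      (l 0 : ℝ)⁻¹ * ‖(x - q b) - (y - q a)‖ := by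
    have ex : gm q (l 0) i x = gm q (l 0) i (q b) + (l 0 : ℝ)⁻¹ • (x - q b) := by
      unfold gm; module
    have ey : gm q (l 0) j y = gm q (l 0) j (q a) + (l 0 : ℝ)⁻¹ • (y - q a) := by
      unfold gm; module
    rw [ex, ey, hv, dist_add_left, dist_eq_norm, ← smul_sub, norm_smul,
      Real.norm_of_nonneg (by positivity)]
  rw [hd, dist_eq_norm, dist_eq_norm]
  have hpos : (0:ℝ) ≤ (l 0 : ℝ)⁻¹ := by positivity
  have := mul_le_mul_of_nonneg_left this hpos
  linarith

/-- Two cells on a common side. -/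
theorem JJ_same (hq : ∀ j k : Fin 3, j ≠ k → dist (q j) (q k) = 1) {l : ℕ → ℕ}
    (hl : ∀ n, 5 ≤ l n) {i j : Fin 3 → ℕ} (hi : i ∈ SS (l 0)) (hj : j ∈ SS (l 0))
    {a b c : Fin 3} (hab : a ≠ b) (hac : a ≠ c) (hbc : b ≠ c) (hic : i c = 0) (hjc : j c = 0)
    (hlt : i b < j b) {x y : E2}
    (hx : x ∈ Gasket q (fun k => l (k + 1))) (hy : y ∈ Gasket q (fun k => l (k + 1))) :
    JJ (Gasket q l) (gm q (l 0) i x) (gm q (l 0) j y)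
      (6 * dist (gm q (l 0) i x) (gm q (l 0) j y)) := by
  have h1 : ∀ n, 1 ≤ l n := fun n => le_trans (by norm_num) (hl n)
  have h5 : (5:ℝ) ≤ l 0 := by exact_mod_cast hl 0
  have hl0 : (l 0 : ℝ) ≠ 0 := by linarith
  have si := hi.1
  have sj := hj.1
  rw [sum3 hab hac hbc] at si sj
  have sir : (i a : ℝ) + i b + 1 = l 0 := by
    rw [hic] at si; exact_mod_cast si
  have vi : gm q (l 0) i (q b) = q a + ((i b + 1 : ℝ) / l 0) • (q b - q a) := by
    have := gm_co (q := q) hi hab hac hbc 1 0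
    rw [hic] at this
    simpa using this
  have vj := gm_vertex (q := q) (h1 0) hj hab hac hbc hjc
  by_cases hb : j b = i b + 1
  · refine JJ_adj hq hl hi hj hab ?_ hx hy
    rw [vi, vj, hb]
    push_cast
    rfl
  · obtain ⟨k, hk⟩ : ∃ k : ℕ, j b = i b + 2 + k := ⟨j b - (i b + 2), by omega⟩
    have hkr : (j b : ℝ) = i b + 2 + k := by exact_mod_cast hk
    have e1 := JJ_gm hl hi (JJ_two hq (fun n => hl _) hx b)
    have e3 := JJ_gm hl hj (JJ_two hq (fun n => hl _) hy a)
    have e2 := JJ_edge hq hab hl (s := (i b + 1 : ℝ) / l 0) (t := (j b : ℝ) / l 0)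
      ⟨by positivity, by
        rw [div_le_one (by linarith)]
        have : (0:ℝ) ≤ i a := by positivity
        linarith⟩ (SS_frac hj b)
    rw [← vi, ← vj] at e2
    refine ((e1.trans e2).trans e3.symm).mono ?_
    obtain ⟨β, γ, hβ, hγ, hs, hxe⟩ := tri_co hab hac hbc
      (Gasket_sub_Tri q _ (fun n => h1 (n + 1)) hx)
    obtain ⟨β', γ', hβ', hγ', hs', hye⟩ := tri_co hab hac hbc
      (Gasket_sub_Tri q _ (fun n => h1 (n + 1)) hy)
    have hd := dist_co hq hab hac hbc ((i b + β) / l 0) ((i c + γ) / l 0)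
      ((j b + β') / l 0) ((j c + γ') / l 0)
    rw [← gm_co hi hab hac hbc, ← gm_co hj hab hac hbc, ← hxe, ← hye, hic, hjc] at hd
    set d := dist (gm q (l 0) i x) (gm q (l 0) j y)
    have d0 : 0 ≤ d := dist_nonneg
    have hd' : (d * l 0) ^ 2 = (2 + k + β' - β) ^ 2 + (2 + k + β' - β) * (γ' - γ)
        + (γ' - γ) ^ 2 := by
      rw [mul_pow, hd, hkr]
      field_simp
      push_cast
      ring
    have k0 : (0:ℝ) ≤ k := by positivity
    have hge : (k + 1 : ℝ) ≤ d * l 0 := by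
      refine abs_le_of_sq_le_sq' ?_ (by positivity) |>.2
      rw [hd']
      have : (k + 1 : ℝ) ≤ (2 + k + β' - β) + (γ' - γ) / 2 := by linarith
      nlinarith [sq_nonneg (γ' - γ)]
    have habs : |(i b + 1 : ℝ) / l 0 - (j b : ℝ) / l 0| = (k + 1) / l 0 := by
      rw [← sub_div, hkr, abs_of_nonpos (div_nonpos_of_nonpos_of_nonneg (by linarith)
        (by linarith)), ← neg_div]
      congr 1
      ring
    rw [habs]
    have : (l 0 : ℝ)⁻¹ * 2 + (k + 1) / l 0 + (l 0 : ℝ)⁻¹ * 2 = (k + 5) / l 0 := by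
      field_simp; ring
    rw [this, div_le_iff₀ (by linarith)]
    linarith

/-- From a cell on a side at `q a` to the inner vertex near `q a`. -/
theorem JJ_half (hq : ∀ j k : Fin 3, j ≠ k → dist (q j) (q k) = 1) {l : ℕ → ℕ}
    (hl : ∀ n, 5 ≤ l n) {i : Fin 3 → ℕ} (hi : i ∈ SS (l 0))
    {a b c : Fin 3} (hab : a ≠ b) (hac : a ≠ c) (hbc : b ≠ c) (hic : i c = 0) (hib : 1 ≤ i b)
    {x : E2} (hx : x ∈ Gasket q (fun k => l (k + 1))) :
    JJ (Gasket q l) (gm q (l 0) i x)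
      (q a + (1 / l 0 : ℝ) • (q b - q a) + (1 / l 0 : ℝ) • (q c - q a)) ((i b + 1) / l 0) := by
  have h1 : ∀ n, 1 ≤ l n := fun n => le_trans (by norm_num) (hl n)
  have h5 : (5:ℝ) ≤ l 0 := by exact_mod_cast hl 0
  have hl0 : (l 0 : ℝ) ≠ 0 := by linarith
  by_cases hb : i b = 1
  · have e := JJ_gm hl hi (JJ_two hq (fun n => hl _) hx c)
    have v := gm_co (q := q) hi hab hac hbc 0 1
    rw [hic, hb] at v
    simp only [zero_smul, add_zero, one_smul, add_sub_cancel, Nat.cast_one, Nat.cast_zero,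
      zero_add] at v
    rw [v] at e
    refine e.mono (le_of_eq ?_)
    rw [hb]
    push_cast
    field_simp
    norm_num
  · obtain ⟨k, hk⟩ : ∃ k : ℕ, i b = k + 2 := ⟨i b - 2, by omega⟩
    have hkr : (i b : ℝ) = k + 2 := by exact_mod_cast hk
    have e1 := JJ_gm hl hi (JJ_two hq (fun n => hl _) hx a)
    have e2 := JJ_edge hq hab hl (SS_frac hi b) (t := 2 / l 0)
      ⟨by positivity, by rw [div_le_one (by linarith)]; linarith⟩
    rw [← gm_vertex (h1 0) hi hab hac hbc hic] at e2
    let i' : Fin 3 → ℕ := fun k => if k = a then l 0 - 2 else if k = b then 1 else 0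
    have i'b : i' b = 1 := by simp [i', hab.symm]
    have i'c : i' c = 0 := by simp [i', hac.symm, hbc.symm]
    have i'a : i' a = l 0 - 2 := by simp [i']
    have hi' : i' ∈ SS (l 0) := by
      refine ⟨?_, c, i'c⟩
      rw [sum3 hab hac hbc, i'a, i'b, i'c]
      have := hl 0
      omega
    have e3 := JJ_edge hq hbc (fun n => hl (n + 1)) (s := 0) (t := 1) (by simp) (by simp)
    have e4 := JJ_gm hl hi' e3
    have v := gm_co (q := q) hi' hab hac hbc 0 1
    have v' := gm_co (q := q) hi' hab hac hbc 1 0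
    rw [i'b, i'c] at v v'
    simp only [zero_smul, add_zero, one_smul, add_sub_cancel, Nat.cast_one, Nat.cast_zero,
      zero_add, zero_div, zero_sub, abs_neg, abs_one] at v v' e4
    rw [show (1 + 1 : ℝ) = 2 by norm_num] at v'
    rw [v, v'] at e4
    refine ((e1.trans e2).trans e4).mono (le_of_eq ?_)
    rw [← sub_div, hkr, abs_of_nonneg (div_nonneg (by simp) (by linarith))]
    field_simp
    ring

theorem diff_arith_aux (m n : ℕ) {A B : ℝ} (hA : (m : ℝ) ≤ A) (hmn : ¬ (m = 0 ∧ n = 0))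
    (h11 : ¬ (m = 1 ∧ n = 1)) (hle : n ≤ m) :
    ((m : ℝ) + 1 + 1 + (n + 1 + 1)) ^ 2 ≤ 36 * (A ^ 2 - A * B + B ^ 2) := by
  have m0 : (0:ℝ) ≤ m := by positivity
  have n0 : (0:ℝ) ≤ n := by positivity
  have hle' : (n : ℝ) ≤ m := by exact_mod_cast hle
  have hsq := pow_le_pow_left₀ m0 hA 2
  have e : 27 * (m : ℝ) ^ 2 ≤ 36 * (A ^ 2 - A * B + B ^ 2) := by
    have h := sq_nonneg (A - 2 * B)
    have : 36 * (A ^ 2 - A * B + B ^ 2) = 27 * A ^ 2 + 9 * (A - 2 * B) ^ 2 := by ring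
    rw [this]
    linarith
  refine le_trans ?_ e
  by_cases h2 : 2 ≤ m
  · have h2' : (2:ℝ) ≤ m := by exact_mod_cast h2
    have h3 : ((m : ℝ) + 1 + 1 + (n + 1 + 1)) ^ 2 ≤ (4 * m) ^ 2 :=
      pow_le_pow_left₀ (by linarith) (by linarith) 2
    have := sq_nonneg (m : ℝ)
    rw [mul_pow] at h3
    linarith
  · have e1 : m = 1 := by omega
    have e2 : n = 0 := by omega
    subst e1 e2
    norm_num

theorem diff_arith (m n : ℕ) {A B : ℝ} (hA : (m : ℝ) ≤ A) (hB : (n : ℝ) ≤ B)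
    (hmn : ¬ (m = 0 ∧ n = 0)) :
    ((m : ℝ) + 1 + 1 + (n + 1 + 1)) ^ 2 ≤ 36 * (A ^ 2 - A * B + B ^ 2) := by
  by_cases h11 : m = 1 ∧ n = 1
  · obtain ⟨rfl, rfl⟩ := h11
    push_cast at hA hB ⊢
    nlinarith [sq_nonneg (A - B), mul_le_mul hA hB (by norm_num) (by linarith)]
  rcases le_total n m with hle | hle
  · exact diff_arith_aux m n hA hmn h11 hle
  · have := diff_arith_aux n m (A := B) (B := A) hB (by tauto) (by tauto) hle
    convert this using 1 <;> ring

/-- Two cells on different sides. -/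
theorem JJ_diff (hq : ∀ j k : Fin 3, j ≠ k → dist (q j) (q k) = 1) {l : ℕ → ℕ}
    (hl : ∀ n, 5 ≤ l n) {i j : Fin 3 → ℕ} (hi : i ∈ SS (l 0)) (hj : j ∈ SS (l 0))
    {a b c : Fin 3} (hab : a ≠ b) (hac : a ≠ c) (hbc : b ≠ c) (hic : i c = 0) (hjb : j b = 0)
    (hib : 1 ≤ i b) (hjc : 1 ≤ j c) {x y : E2}
    (hx : x ∈ Gasket q (fun k => l (k + 1))) (hy : y ∈ Gasket q (fun k => l (k + 1))) :
    JJ (Gasket q l) (gm q (l 0) i x) (gm q (l 0) j y)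
      (6 * dist (gm q (l 0) i x) (gm q (l 0) j y)) := by
  have h1 : ∀ n, 1 ≤ l n := fun n => le_trans (by norm_num) (hl n)
  have h5 : (5:ℝ) ≤ l 0 := by exact_mod_cast hl 0
  have hl0 : (l 0 : ℝ) ≠ 0 := by linarith
  by_cases hone : i b = 1 ∧ j c = 1
  · refine JJ_adj hq hl hi hj hbc ?_ hx hy
    have v := gm_co (q := q) hi hab hac hbc 0 1
    have v' := gm_co (q := q) hj hab hac hbc 1 0
    rw [hic, hone.1] at v
    rw [hjb, hone.2] at v'
    simp only [zero_smul, add_zero, one_smul, add_sub_cancel, Nat.cast_one, Nat.cast_zero,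
      zero_add] at v v'
    rw [v, v']
  · have e1 := JJ_half hq hl hi hab hac hbc hic hib hx
    have e2 := JJ_half hq hl hj hac hab hbc.symm hjb hjc hy
    rw [add_right_comm] at e2
    refine (e1.trans e2.symm).mono ?_
    obtain ⟨β, γ, hβ, hγ, hs, hxe⟩ := tri_co hab hac hbc
      (Gasket_sub_Tri q _ (fun n => h1 (n + 1)) hx)
    obtain ⟨β', γ', hβ', hγ', hs', hye⟩ := tri_co hab hac hbc
      (Gasket_sub_Tri q _ (fun n => h1 (n + 1)) hy)
    have hd := dist_co hq hab hac hbc ((i b + β) / l 0) ((i c + γ) / l 0)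
      ((j b + β') / l 0) ((j c + γ') / l 0)
    rw [← gm_co hi hab hac hbc, ← gm_co hj hab hac hbc, ← hxe, ← hye, hic, hjb] at hd
    set d := dist (gm q (l 0) i x) (gm q (l 0) j y)
    have d0 : 0 ≤ d := dist_nonneg
    obtain ⟨m, hm⟩ : ∃ m : ℕ, i b = m + 1 := ⟨i b - 1, by omega⟩
    obtain ⟨n, hn⟩ : ∃ n : ℕ, j c = n + 1 := ⟨j c - 1, by omega⟩
    have hmr : (i b : ℝ) = m + 1 := by exact_mod_cast hm
    have hnr : (j c : ℝ) = n + 1 := by exact_mod_cast hn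
    obtain ⟨A, hA⟩ : ∃ A : ℝ, A = m + 1 + β - β' := ⟨_, rfl⟩
    obtain ⟨B, hB⟩ : ∃ B : ℝ, B = n + 1 + γ' - γ := ⟨_, rfl⟩
    have hAm : (m : ℝ) ≤ A := by linarith
    have hBn : (n : ℝ) ≤ B := by linarith
    have m0 : (0:ℝ) ≤ m := by positivity
    have n0 : (0:ℝ) ≤ n := by positivity
    have hd' : (d * l 0) ^ 2 = A ^ 2 - A * B + B ^ 2 := by
      rw [mul_pow, hd, hmr, hnr, hA, hB]
      field_simp
      push_cast
      ring
    rw [← add_div, hmr, hnr, div_le_iff₀ (by linarith)]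
    refine abs_le_of_sq_le_sq' ?_ (by positivity) |>.2
    have : (6 * d * l 0) ^ 2 = 36 * (d * l 0) ^ 2 := by ring
    rw [this, hd']
    have hmn : ¬ (m = 0 ∧ n = 0) := by
      rintro ⟨rfl, rfl⟩
      exact hone ⟨hm, hn⟩
    exact diff_arith m n hAm hBn hmn

theorem JJ_ne (hq : ∀ j k : Fin 3, j ≠ k → dist (q j) (q k) = 1) {l : ℕ → ℕ}
    (hl : ∀ n, 5 ≤ l n) {i j : Fin 3 → ℕ} (hi : i ∈ SS (l 0)) (hj : j ∈ SS (l 0)) (hij : i ≠ j)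
    {x y : E2}
    (hx : x ∈ Gasket q (fun k => l (k + 1))) (hy : y ∈ Gasket q (fun k => l (k + 1))) :
    JJ (Gasket q l) (gm q (l 0) i x) (gm q (l 0) j y)
      (6 * dist (gm q (l 0) i x) (gm q (l 0) j y)) := by
  by_cases hcom : ∃ c, i c = 0 ∧ j c = 0
  · obtain ⟨c, hic, hjc⟩ := hcom
    obtain ⟨a, b, hab, hac, hbc⟩ := others c
    rcases lt_trichotomy (i b) (j b) with h | h | h
    · exact JJ_same hq hl hi hj hab hac hbc hic hjc h hx hy
    · exfalso
      apply hij
      have si := hi.1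
      have sj := hj.1
      rw [sum3 hab hac hbc] at si sj
      funext k
      have hk3 : k = a ∨ k = b ∨ k = c := by
        clear hic hjc h si sj
        revert a b c k; decide
      rcases hk3 with rfl | rfl | rfl <;> omega
    · rw [dist_comm]
      exact (JJ_same hq hl hj hi hab hac hbc hjc hic h hy hx).symm
  · obtain ⟨c, hic⟩ := hi.2
    obtain ⟨b, hjb⟩ := hj.2
    have hbc : b ≠ c := by
      rintro rfl
      exact hcom ⟨b, hic, hjb⟩
    obtain ⟨a, hab, hac⟩ : ∃ a, a ≠ b ∧ a ≠ c := by
      clear hic hjb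
      revert b c; decide
    have h1 : i b ≠ 0 := fun h => hcom ⟨b, h, hjb⟩
    have h2 : j c ≠ 0 := fun h => hcom ⟨c, hic, h⟩
    exact JJ_diff hq hl hi hj hab hac hbc hic hjb (by omega) (by omega) hx hy

theorem JJ_main (hq : ∀ j k : Fin 3, j ≠ k → dist (q j) (q k) = 1)
    {l : ℕ → ℕ} (hl : ∀ n, 5 ≤ l n) {x y : E2} (hx : x ∈ Gasket q l) (hy : y ∈ Gasket q l) :
    JJ (Gasket q l) x y (6 * dist x y) := by
  have main : ∀ n : ℕ, ∀ l : ℕ → ℕ, (∀ n, 5 ≤ l n) → ∀ x ∈ Gasket q l, ∀ y ∈ Gasket q l,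
      (1 / 5 : ℝ) ^ n < dist x y → JJ (Gasket q l) x y (6 * dist x y) := by
    intro n
    induction n with
    | zero =>
      intro l hl x hx y hy h
      have h1 : ∀ n, 1 ≤ l n := fun n => le_trans (by norm_num) (hl n)
      have := dist_le_one q hq (Gasket_sub_Tri q l h1 hx) (Gasket_sub_Tri q l h1 hy)
      rw [pow_zero] at h
      linarith
    | succ n ih =>
      intro l hl x hx y hy h
      have h1 : ∀ n, 1 ≤ l n := fun n => le_trans (by norm_num) (hl n)
      obtain ⟨i, hi, x', hx', rfl⟩ := exists_cell q h1 hx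
      obtain ⟨j, hj, y', hy', rfl⟩ := exists_cell q h1 hy
      by_cases hij : i = j
      · subst hij
        rw [gm_dist, pow_succ'] at h
        have h5 : (5:ℝ) ≤ l 0 := by exact_mod_cast hl 0
        have hinv : (l 0 : ℝ)⁻¹ ≤ 1 / 5 := by
          rw [one_div]; exact inv_anti₀ (by norm_num) h5
        have h6 := mul_le_mul_of_nonneg_right hinv (dist_nonneg (x := x') (y := y'))
        have e := JJ_gm hl hi (ih _ (fun n => hl _) x' hx' y' hy' (by linarith))
        refine e.mono (le_of_eq ?_)
        rw [gm_dist]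
        ring
      · exact JJ_ne hq hl hi hj hij hx' hy'
  by_cases h : x = y
  · subst h
    exact JJ.refl hx (by positivity)
  · obtain ⟨n, hn⟩ := exists_pow_lt_of_lt_one (dist_pos.2 h) (show (1 / 5 : ℝ) < 1 by norm_num)
    exact main n l hl x hx y hy hn

end


/-- The intrinsic path distance `d` is a geodesic metric on `K`
comparable to the Euclidean metric: `|x−y| ≤ d(x,y) ≤ 6|x−y|`. -/
theorem stmt1 (q : Fin 3 → E2) (hq : ∀ j k : Fin 3, j ≠ k → dist (q j) (q k) = 1)
    (l : ℕ → ℕ) (hl : ∀ n, 5 ≤ l n) :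
    (∀ x ∈ Gasket q l, ∀ y ∈ Gasket q l, (pdist q l x y = 0 ↔ x = y)) ∧
    (∀ x ∈ Gasket q l, ∀ y ∈ Gasket q l, pdist q l x y = pdist q l y x) ∧
    (∀ x ∈ Gasket q l, ∀ y ∈ Gasket q l, ∀ z ∈ Gasket q l,
      pdist q l x z ≤ pdist q l x y + pdist q l y z) ∧
    (∀ x ∈ Gasket q l, ∀ y ∈ Gasket q l, ∃ γ : ℝ → E2,
      ContinuousOn γ (Set.Icc 0 1) ∧ Set.MapsTo γ (Set.Icc 0 1) (Gasket q l) ∧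
      γ 0 = x ∧ γ 1 = y ∧
      ∀ s ∈ Set.Icc (0:ℝ) 1, ∀ t ∈ Set.Icc (0:ℝ) 1,
        pdist q l (γ s) (γ t) = ENNReal.ofReal |s - t| * pdist q l x y) ∧
    (∀ x ∈ Gasket q l, ∀ y ∈ Gasket q l,
      ENNReal.ofReal (dist x y) ≤ pdist q l x y ∧
      pdist q l x y ≤ ENNReal.ofReal (6 * dist x y)) := by
  have h1 : ∀ n, 1 ≤ l n := fun n => le_trans (by norm_num) (hl n)
  have h6 : ∀ x ∈ Gasket q l, ∀ y ∈ Gasket q l,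
      pdist q l x y ≤ ENNReal.ofReal (6 * dist x y) :=
    fun x hx y hy => pdist_le_of_JJ q l (JJ_main hq hl hx hy)
  refine ⟨fun x hx y hy => ⟨fun h => ?_, ?_⟩, fun x _ y _ => pdist_symm q l x y,
    fun x _ y _ z _ => pdist_triangle q l x y z,
    fun x hx y hy => geod_exists q l (Gasket_compact q l h1) h6 hx hy,
    fun x hx y hy => ⟨edist_le_pdist q l x y, h6 x hx y hy⟩⟩
  · have h2 := edist_le_pdist q l x y
    rw [h] at h2
    have h3 := ENNReal.ofReal_eq_zero.1 (le_antisymm h2 bot_le)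
    exact dist_le_zero.1 h3
  · rintro rfl
    have h2 := h6 x hx x hx
    simpa using h2
end
end
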